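/- Let Ω = (−1,1)^d with d ≥ 2, let p > 1, α > 0 and q > p + α·max{1, (p−1)/(d−1)}. Then there exist a nonnegative weight a ∈ C^{0,α}(Ω̄) and a vector field b° ∈ L^1(Ω;ℝ^d), supported in a compact subset of Ω and satisfying ∫_Ω φ*(x, |b°(x)|) dx < ∞, where φ(x,t) := t^p/p + a(x)·t^q/q and φ*(x,s) := sup_{t≥0}(st − φ(x,t)), such that: (i) ∫_Ω b° · ∇v dx = 0 for every v ∈ C^∞(Ω), hence G(v) := ∫_Ω φ(x, |∇v(x)|) dx + ∫_Ω b° · ∇v dx ≥ 0 for every v ∈ C_c^∞(Ω) and G(0) = 0; (ii) there exists w ∈ W_0^{1,1}(Ω) with ∫_Ω φ(x, |∇w(x)|) dx < ∞ and G(w) < 0. Thus the double phase functional exhibits a Lavrentiev gap, without any requirement that p and q straddle the dimension d. -/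

import Mathlib

open MeasureTheory Set Metric Filter
open scoped RealInnerProductSpace ENNReal NNReal Topology

noncomputable section

/-- `ℝ^d` with the Euclidean structure. -/
abbrev E (d : ℕ) := EuclideanSpace ℝ (Fin d)

/-- The open cube `Ω = (-1,1)^m`. -/
def cube (m : ℕ) : Set (E m) := {x | ∀ i, x i ∈ Set.Ioo (-1:ℝ) 1}

/-- `w ∈ W_0^{1,1}(Ω)` for `Ω = (−1,1)^d`, with weak gradient `g`: `w` and `g` are
integrable on `Ω` and the extension of `w` by zero has weak gradient (the extension of)
`g` on `ℝ^d`, i.e. `∫_Ω w ∂_i ξ dx = −∫_Ω g_i ξ dx` for all `ξ ∈ C_c^∞(ℝ^d)`. -/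
def MemW011 (d : ℕ) (w : E d → ℝ) (g : E d → E d) : Prop :=
  IntegrableOn w (cube d) volume ∧ IntegrableOn g (cube d) volume ∧
  ∀ ξ : E d → ℝ, ContDiff ℝ (⊤ : ℕ∞) ξ → HasCompactSupport ξ → ∀ i : Fin d,
    ∫ x in cube d, w x * fderiv ℝ ξ x (EuclideanSpace.single i 1) =
      - ∫ x in cube d, g x i * ξ x

/-- The Young conjugate `φ*(s) = sup_{t ≥ 0} (s t − φ(t))`. -/
def conjFn (φ : ℝ → ℝ) (s : ℝ) : ℝ := ⨆ t : ℝ≥0, (s * t - φ t)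

/-- The double phase integrand `φ(x,t) = t^p/p + a(x) t^q/q`. -/
def doublePhase (p q : ℝ) (a : ℝ) (t : ℝ) : ℝ := t ^ p / p + a * t ^ q / q

section

/-! ## One-dimensional Cantor parametrisations -/

def cT (l : ℝ) (t : ℝ) : ℝ := (1 - 2 * l) / 4 * ∑' n : ℕ, l ^ n * (⌊(2:ℝ) ^ n * t⌋ : ℝ)

lemma cT_summable {l : ℝ} (h0 : 0 < l) (h1 : l < 1 / 2) (t : ℝ) :
    Summable (fun n : ℕ => l ^ n * (⌊(2:ℝ) ^ n * t⌋ : ℝ)) := by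
  have hs : Summable (fun n : ℕ => |t| * (2 * l) ^ n + l ^ n) := by
    apply Summable.add
    · exact (summable_geometric_of_lt_one (by positivity) (by linarith)).mul_left _
    · exact summable_geometric_of_lt_one h0.le (by linarith)
  refine Summable.of_norm_bounded hs (fun n => ?_)
  rw [norm_mul, Real.norm_of_nonneg (by positivity), mul_pow]
  have : ‖(⌊(2:ℝ) ^ n * t⌋ : ℝ)‖ ≤ 2 ^ n * |t| + 1 := by
    rw [Real.norm_eq_abs, abs_le]
    have h2 : (0:ℝ) < 2 ^ n := by positivity
    have a1 := Int.floor_le ((2:ℝ) ^ n * t)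
    have a2 := Int.lt_floor_add_one ((2:ℝ) ^ n * t)
    have a3 : (2:ℝ) ^ n * t ≤ 2 ^ n * |t| := mul_le_mul_of_nonneg_left (le_abs_self t) h2.le
    have a4 : -((2:ℝ) ^ n * |t|) ≤ 2 ^ n * t := by
      have := mul_le_mul_of_nonneg_left (neg_abs_le t) h2.le
      linarith
    constructor <;> linarith
  calc l ^ n * ‖(⌊(2:ℝ) ^ n * t⌋ : ℝ)‖ ≤ l ^ n * (2 ^ n * |t| + 1) := by gcongr
    _ = _ := by ring

lemma cT_sub {l : ℝ} (h0 : 0 < l) (h1 : l < 1 / 2) (s t : ℝ) :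
    cT l t - cT l s = (1 - 2 * l) / 4 *
      ∑' n : ℕ, l ^ n * ((⌊(2:ℝ) ^ n * t⌋ : ℝ) - ⌊(2:ℝ) ^ n * s⌋) := by
  unfold cT
  rw [← mul_sub, ← (cT_summable h0 h1 t).tsum_sub (cT_summable h0 h1 s)]
  congr 2
  ext n
  ring

lemma cT_sub_summable {l : ℝ} (h0 : 0 < l) (h1 : l < 1 / 2) (s t : ℝ) :
    Summable fun n : ℕ => l ^ n * ((⌊(2:ℝ) ^ n * t⌋ : ℝ) - ⌊(2:ℝ) ^ n * s⌋) := by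
  refine ((cT_summable h0 h1 t).sub (cT_summable h0 h1 s)).congr (fun n => ?_)
  ring

lemma cT_term_nonneg {l : ℝ} (h0 : 0 < l) {s t : ℝ} (hst : s ≤ t) (n : ℕ) :
    0 ≤ l ^ n * ((⌊(2:ℝ) ^ n * t⌋ : ℝ) - ⌊(2:ℝ) ^ n * s⌋) := by
  apply mul_nonneg (by positivity)
  have : ⌊(2:ℝ) ^ n * s⌋ ≤ ⌊(2:ℝ) ^ n * t⌋ := Int.floor_mono (by gcongr)
  have : (⌊(2:ℝ) ^ n * s⌋ : ℝ) ≤ ⌊(2:ℝ) ^ n * t⌋ := by exact_mod_cast this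
  linarith

lemma cT_mono {l : ℝ} (h0 : 0 < l) (h1 : l < 1 / 2) : Monotone (cT l) := by
  intro s t hst
  have := cT_sub h0 h1 s t
  have h2 : 0 ≤ ∑' n : ℕ, l ^ n * ((⌊(2:ℝ) ^ n * t⌋ : ℝ) - ⌊(2:ℝ) ^ n * s⌋) :=
    tsum_nonneg (cT_term_nonneg h0 hst)
  have : 0 ≤ cT l t - cT l s := by
    rw [this]; apply mul_nonneg _ h2; linarith
  linarith

lemma cT_zero (l : ℝ) : cT l 0 = 0 := by simp [cT]

lemma cT_one {l : ℝ} (h0 : 0 < l) (h1 : l < 1 / 2) : cT l 1 = 1 / 4 := by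
  unfold cT
  have : ∀ n : ℕ, l ^ n * (⌊(2:ℝ) ^ n * 1⌋ : ℝ) = (2 * l) ^ n := by
    intro n
    have : ⌊(2:ℝ) ^ n * 1⌋ = (2:ℤ) ^ n := by
      rw [mul_one]
      have := Int.floor_intCast (R := ℝ) ((2:ℤ) ^ n)
      push_cast at this
      exact this
    rw [this]; push_cast; ring
  simp_rw [this]
  rw [tsum_geometric_of_lt_one (by positivity) (by linarith)]
  have : 1 - 2 * l ≠ 0 := by linarith
  field_simp

/-- lower bound on increments -/
lemma cT_lower {l : ℝ} (h0 : 0 < l) (h1 : l < 1 / 2) {s t : ℝ} (n : ℕ)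
    (hst : s + (1 / 2) ^ n ≤ t) : (1 - 2 * l) / 4 * l ^ n ≤ cT l t - cT l s := by
  have hle : s ≤ t := by
    have : (0:ℝ) < (1 / 2) ^ n := by positivity
    linarith
  rw [cT_sub h0 h1]
  apply mul_le_mul_of_nonneg_left _ (by linarith)
  refine le_trans ?_ ((cT_sub_summable h0 h1 s t).le_tsum n
    (fun m _ => cT_term_nonneg h0 hle m))
  have : ⌊(2:ℝ) ^ n * s⌋ + 1 ≤ ⌊(2:ℝ) ^ n * t⌋ := by
    rw [Int.le_floor]
    push_cast
    have := Int.floor_le ((2:ℝ) ^ n * s)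
    have h2 : (2:ℝ) ^ n * (s + (1 / 2) ^ n) ≤ 2 ^ n * t := by gcongr
    have h3 : (2:ℝ) ^ n * (1 / 2) ^ n = 1 := by rw [← mul_pow]; norm_num
    rw [mul_add, h3] at h2
    linarith
  have : (⌊(2:ℝ) ^ n * s⌋ : ℝ) + 1 ≤ ⌊(2:ℝ) ^ n * t⌋ := by exact_mod_cast this
  have h4 : 0 < l ^ n := by positivity
  nlinarith

/-- upper bound on increments inside dyadic cells -/
lemma cT_upper {l : ℝ} (h0 : 0 < l) (h1 : l < 1 / 2) {t : ℝ} (n : ℕ) :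
    cT l t - cT l ((⌊(2:ℝ) ^ n * t⌋ : ℝ) / 2 ^ n) ≤ l ^ n / 2 := by
  set s : ℝ := (⌊(2:ℝ) ^ n * t⌋ : ℝ) / 2 ^ n with hs
  have h2n : (0:ℝ) < 2 ^ n := by positivity
  have hsn : (2:ℝ) ^ n * s = ⌊(2:ℝ) ^ n * t⌋ := by rw [hs]; field_simp
  have hst : s ≤ t := by
    have := Int.floor_le ((2:ℝ) ^ n * t)
    rw [← hsn] at this
    exact le_of_mul_le_mul_left this h2n
  have hts : (2:ℝ) ^ n * (t - s) ≤ 1 := by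
    rw [mul_sub, hsn]
    have := Int.lt_floor_add_one ((2:ℝ) ^ n * t)
    linarith
  rw [cT_sub h0 h1, ← (cT_sub_summable h0 h1 s t).sum_add_tsum_nat_add n]
  have hz : ∑ i ∈ Finset.range n, l ^ i * ((⌊(2:ℝ) ^ i * t⌋ : ℝ) - ⌊(2:ℝ) ^ i * s⌋) = 0 := by
    apply Finset.sum_eq_zero
    intro m hm
    rw [Finset.mem_range] at hm
    obtain ⟨r, rfl⟩ := Nat.exists_eq_add_of_lt hm
    have : ⌊(2:ℝ) ^ m * t⌋ = ⌊(2:ℝ) ^ m * s⌋ := by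
      apply le_antisymm
      · rw [Int.le_floor]
        have a1 := Int.floor_le ((2:ℝ) ^ m * t)
        have a2 : ⌊(2:ℝ) ^ m * t⌋ * (2:ℤ) ^ (r + 1) ≤ ⌊(2:ℝ) ^ (m + r + 1) * t⌋ := by
          rw [Int.le_floor]
          push_cast
          calc (⌊(2:ℝ) ^ m * t⌋ : ℝ) * 2 ^ (r + 1) ≤ (2:ℝ) ^ m * t * 2 ^ (r + 1) := by gcongr
            _ = _ := by ring
        have a3 : (⌊(2:ℝ) ^ m * t⌋ : ℝ) * (2:ℝ) ^ (r + 1) ≤ ⌊(2:ℝ) ^ (m + r + 1) * t⌋ := by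
          exact_mod_cast a2
        rw [← hsn] at a3
        have : (0:ℝ) < 2 ^ (r + 1) := by positivity
        refine le_of_mul_le_mul_right (a3.trans_eq ?_) this
        ring
      · exact Int.floor_mono (by gcongr)
    rw [this]; simp
  rw [hz, zero_add]
  have hb : ∀ k : ℕ, l ^ (k + n) * ((⌊(2:ℝ) ^ (k + n) * t⌋ : ℝ) - ⌊(2:ℝ) ^ (k + n) * s⌋)
      ≤ 2 * l ^ n * (2 * l) ^ k := by
    intro k
    have a1 := Int.floor_le ((2:ℝ) ^ (k + n) * t)
    have a2 := Int.lt_floor_add_one ((2:ℝ) ^ (k + n) * s)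
    have a3 : (2:ℝ) ^ (k + n) * (t - s) ≤ 2 ^ k := by
      calc (2:ℝ) ^ (k + n) * (t - s) = 2 ^ k * (2 ^ n * (t - s)) := by ring
        _ ≤ 2 ^ k * 1 := by gcongr
        _ = _ := by ring
    have a4 : (1:ℝ) ≤ 2 ^ k := one_le_pow₀ (by norm_num)
    have a5 : ((⌊(2:ℝ) ^ (k + n) * t⌋ : ℝ) - ⌊(2:ℝ) ^ (k + n) * s⌋) ≤ 2 * 2 ^ k := by linarith
    calc _ ≤ l ^ (k + n) * (2 * 2 ^ k) := by gcongr
      _ = _ := by ring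
  have hsum : Summable (fun k : ℕ => 2 * l ^ n * (2 * l) ^ k) :=
    (summable_geometric_of_lt_one (by positivity) (by linarith)).mul_left _
  have := Summable.tsum_le_tsum hb ((summable_nat_add_iff n).2 (cT_sub_summable h0 h1 s t)) hsum
  rw [tsum_mul_left, tsum_geometric_of_lt_one (by positivity) (by linarith)] at this
  calc _ ≤ (1 - 2 * l) / 4 * (2 * l ^ n * (1 - 2 * l)⁻¹) := by
        apply mul_le_mul_of_nonneg_left this (by linarith)
    _ = l ^ n / 2 := by
        have : 1 - 2 * l ≠ 0 := by linarith
        field_simp; norm_num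

lemma cT_frostman {l D : ℝ} (h0 : 0 < l) (h1 : l < 1 / 2) (hD : 0 < D)
    (hl : l ^ D = 1 / 2) : ∃ C : ℝ, 0 < C ∧ ∀ x h : ℝ, 0 < h →
    volume.real {t ∈ Icc (0:ℝ) 1 | |x - cT l t| ≤ h} ≤ C * h ^ D := by
  set c : ℝ := (1 - 2 * l) / 4 with hc
  have hc0 : 0 < c := by rw [hc]; linarith
  refine ⟨4 * (3 / (c * l)) ^ D, by positivity, fun x h hh => ?_⟩
  set A := {t ∈ Icc (0:ℝ) 1 | |x - cT l t| ≤ h} with hA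
  rw [mul_assoc, ← Real.mul_rpow (by positivity) hh.le]
  by_cases hbig : c * l ≤ 3 * h
  · have b1 : volume.real A ≤ 1 := by
      have : volume.real A ≤ volume.real (Icc (0:ℝ) 1) :=
        measureReal_mono (fun t ht => ht.1) (by simp)
      simpa using this
    have b2 : 1 ≤ (3 / (c * l) * h) ^ D := by
      apply Real.one_le_rpow _ hD.le
      rw [div_mul_eq_mul_div, le_div_iff₀ (by positivity)]; linarith
    linarith
  push Not at hbig
  obtain ⟨n, hn1, hn2⟩ := exists_nat_pow_near_of_lt_one (x := 3 * h / c) (y := l) (by positivity)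
    (by rw [div_le_one hc0]; nlinarith) h0 (by linarith)
  have key : ∀ s ∈ A, ∀ t ∈ A, s ≤ t → t - s ≤ (1 / 2) ^ n := by
    intro s hs t ht hst
    by_contra hcon
    push Not at hcon
    have := cT_lower h0 h1 (s := s) (t := t) n (by linarith)
    have b1 := abs_le.1 hs.2
    have b2 := abs_le.1 ht.2
    rw [← hc] at this
    have b3 : c * (3 * h / c) ≤ c * l ^ n := by gcongr
    have b4 : c * (3 * h / c) = 3 * h := by field_simp
    linarith [b1.1, b1.2, b2.1, b2.2]
  have hvol : volume.real A ≤ 2 * (1 / 2) ^ n := by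
    rcases A.eq_empty_or_nonempty with he | ⟨t0, ht0⟩
    · rw [he]; simp
    · have : volume.real A ≤ volume.real (Icc (t0 - (1 / 2) ^ n) (t0 + (1 / 2) ^ n)) := by
        apply measureReal_mono _ (by simp)
        intro t ht
        rcases le_total t t0 with h | h
        · have := key t ht t0 ht0 h
          constructor
          · linarith
          · have : (0:ℝ) < (1 / 2) ^ n := by positivity
            linarith
        · have := key t0 ht0 t ht h
          constructor
          · have : (0:ℝ) < (1 / 2) ^ n := by positivity
            linarith
          · linarith
      refine this.trans_eq ?_
      rw [Real.volume_real_Icc_of_le (by have : (0:ℝ) < (1 / 2) ^ n := by positivity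
                                         linarith)]
      ring
  have : (1 / 2 : ℝ) ^ n ≤ 2 * (3 / (c * l) * h) ^ D := by
    have e1 : l ^ (n + 1) / l ≤ 3 / (c * l) * h := by
      rw [div_le_iff₀ h0]
      refine hn1.le.trans_eq ?_
      field_simp
    have e2 : l ^ (n + 1) / l = l ^ n := by rw [pow_succ]; field_simp
    rw [e2] at e1
    have e3 : (l ^ n) ^ D ≤ (3 / (c * l) * h) ^ D := Real.rpow_le_rpow (by positivity) e1 hD.le
    have e4 : (l ^ n) ^ D = (1 / 2 : ℝ) ^ n := by
      rw [← hl, ← Real.rpow_natCast, ← Real.rpow_natCast, ← Real.rpow_mul h0.le,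
        ← Real.rpow_mul h0.le, mul_comm]
    rw [e4] at e3
    have : 0 ≤ (3 / (c * l) * h) ^ D := by positivity
    linarith
  linarith

lemma cT_nbhd {l : ℝ} (h0 : 0 < l) (h1 : l < 1 / 2) (n : ℕ) :
    volume {x : ℝ | infDist x (cT l '' Icc 0 1) ≤ l ^ n} ≤ ENNReal.ofReal (12 * (2 * l) ^ n) := by
  have hne : (cT l '' Icc 0 1).Nonempty := ⟨_, 0, by simp, rfl⟩
  have hl : 0 < l ^ n := by positivity
  have hsub : {x : ℝ | infDist x (cT l '' Icc 0 1) ≤ l ^ n} ⊆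
      ⋃ j ∈ Finset.range (2 ^ n + 1), Icc (cT l ((j:ℝ) / 2 ^ n) - 2 * l ^ n)
        (cT l ((j:ℝ) / 2 ^ n) + 3 * l ^ n) := by
    intro x hx
    have : infDist x (cT l '' Icc 0 1) < 2 * l ^ n := lt_of_le_of_lt hx (by linarith)
    rw [infDist_lt_iff hne] at this
    obtain ⟨_, ⟨t, ht, rfl⟩, hxt⟩ := this
    rw [Real.dist_eq, abs_lt] at hxt
    have hfl : 0 ≤ ⌊(2:ℝ) ^ n * t⌋ := Int.floor_nonneg.2 (mul_nonneg (by positivity) ht.1)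
    obtain ⟨j, hj⟩ := Int.eq_ofNat_of_zero_le hfl
    have hu := cT_upper h0 h1 (t := t) n
    rw [hj] at hu
    have hj' := Int.floor_le ((2:ℝ) ^ n * t)
    rw [hj] at hj'
    push_cast at hu hj'
    have h2n : (0:ℝ) < 2 ^ n := by positivity
    have hjt : (j:ℝ) / 2 ^ n ≤ t := by rw [div_le_iff₀ h2n]; linarith
    have hm := cT_mono h0 h1 hjt
    have hjn : j ≤ 2 ^ n := by
      have : (j:ℝ) ≤ 2 ^ n := hj'.trans (by nlinarith [ht.2])
      exact_mod_cast this
    simp only [mem_iUnion, Finset.mem_range]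
    refine ⟨j, by omega, ?_, ?_⟩ <;> linarith
  refine (measure_mono hsub).trans ((measure_biUnion_finset_le _ _).trans ?_)
  have : ∀ j ∈ Finset.range (2 ^ n + 1), volume (Icc (cT l ((j:ℝ) / 2 ^ n) - 2 * l ^ n)
        (cT l ((j:ℝ) / 2 ^ n) + 3 * l ^ n)) = ENNReal.ofReal (5 * l ^ n) := by
    intro j _
    rw [Real.volume_Icc]
    congr 1; ring
  rw [Finset.sum_congr rfl this, Finset.sum_const, Finset.card_range, nsmul_eq_mul,
    ← ENNReal.ofReal_natCast, ← ENNReal.ofReal_mul (by positivity)]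
  apply ENNReal.ofReal_le_ofReal
  push_cast
  have a4 : (1:ℝ) ≤ 2 ^ n := one_le_pow₀ (by norm_num)
  rw [mul_pow]
  nlinarith [mul_pos hl (by linarith : (0:ℝ) < 2 ^ n)]

lemma cT_null {l : ℝ} (h0 : 0 < l) (h1 : l < 1 / 2) :
    volume {x : ℝ | infDist x (cT l '' Icc 0 1) = 0} = 0 := by
  have ht : Tendsto (fun n : ℕ => ENNReal.ofReal (12 * (2 * l) ^ n)) atTop (𝓝 0) := by
    rw [← ENNReal.ofReal_zero]
    apply ENNReal.tendsto_ofReal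
    have := (tendsto_pow_atTop_nhds_zero_of_lt_one (r := 2 * l) (by positivity)
      (by linarith)).const_mul 12
    simpa using this
  refine le_antisymm (ge_of_tendsto' ht (fun n => ?_)) (zero_le)
  refine le_trans (measure_mono ?_) (cT_nbhd h0 h1 n)
  intro x hx
  simp only [mem_setOf_eq] at hx ⊢
  rw [hx]; positivity

lemma cT_integrable {l D s : ℝ} (h0 : 0 < l) (h1 : l < 1 / 2)
    (hl : l ^ D = 1 / 2) (hs0 : 0 < s) (hs : s < 1 - D) :
    IntegrableOn (fun x => (infDist x (cT l '' Icc 0 1)) ^ (-s)) (Icc (-1) 1) := by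
  set ρ : ℝ → ℝ := fun x => infDist x (cT l '' Icc 0 1) with hρ
  have hρc : Continuous ρ := continuous_infDist_pt _
  have hρ0 : ∀ x, 0 ≤ ρ x := fun x => infDist_nonneg
  have hmeas : Measurable (fun x => ρ x ^ (-s)) := hρc.measurable.pow_const _
  refine ⟨hmeas.aestronglyMeasurable, ?_⟩
  rw [hasFiniteIntegral_iff_ofReal (Eventually.of_forall (fun x => Real.rpow_nonneg (hρ0 x) _))]
  set F : ℕ → ℝ → ℝ≥0∞ := fun n => ({x | ρ x ≤ l ^ n} : Set ℝ).indicator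
    (fun _ => ENNReal.ofReal ((l ^ (n + 1)) ^ (-s))) with hF
  have hSm : ∀ n : ℕ, MeasurableSet {x | ρ x ≤ l ^ n} := fun n =>
    measurableSet_le hρc.measurable measurable_const
  have hbound : ∀ x ∈ Icc (-1:ℝ) 1, ENNReal.ofReal (ρ x ^ (-s)) ≤ 1 + ∑' n, F n x := by
    intro x _
    rcases (hρ0 x).eq_or_lt with he | hpos
    · rw [← he, Real.zero_rpow (by linarith)]; simp
    rcases le_or_gt (ρ x) 1 with hle | hgt
    · obtain ⟨n, hn1, hn2⟩ := exists_nat_pow_near_of_lt_one hpos hle h0 (by linarith)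
      refine le_trans ?_ (le_add_left (ENNReal.le_tsum n))
      simp only [hF, indicator, mem_setOf_eq, hn2, if_true]
      apply ENNReal.ofReal_le_ofReal
      exact Real.rpow_le_rpow_of_nonpos (by positivity) hn1.le (by linarith)
    · refine le_trans ?_ le_self_add
      rw [← ENNReal.ofReal_one]
      apply ENNReal.ofReal_le_ofReal
      exact Real.rpow_le_one_of_one_le_of_nonpos hgt.le (by linarith)
  refine lt_of_le_of_lt (setLIntegral_mono' measurableSet_Icc hbound) ?_
  rw [lintegral_add_left measurable_const]
  refine ENNReal.add_lt_top.2 ⟨by simp, ?_⟩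
  rw [lintegral_tsum (fun n => (measurable_const.indicator (hSm n)).aemeasurable)]
  set κ : ℝ := 2 * l * l ^ (-s) with hκ
  have hκ0 : 0 < κ := by positivity
  have hκ1 : κ < 1 := by
    have e1 : l ^ (1 - s) < l ^ D :=
      Real.rpow_lt_rpow_of_exponent_gt h0 (by linarith) (by linarith)
    have e2 : l ^ (1 - s) = l * l ^ (-s) := by
      rw [sub_eq_add_neg, Real.rpow_add h0, Real.rpow_one]
    rw [hl, e2] at e1
    rw [hκ]; nlinarith
  have hterm : ∀ n, ∫⁻ x in Icc (-1:ℝ) 1, F n x ≤ ENNReal.ofReal (12 * l ^ (-s) * κ ^ n) := by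
    intro n
    rw [hF, lintegral_indicator_const (hSm n)]
    have e1 := (Measure.restrict_apply_le (μ := volume) (Icc (-1:ℝ) 1) {x | ρ x ≤ l ^ n}).trans
      (cT_nbhd h0 h1 n)
    refine (mul_le_mul_right e1 _).trans_eq ?_
    rw [← ENNReal.ofReal_mul (by positivity)]
    congr 1
    have : (l ^ (n + 1)) ^ (-s) = (l ^ (-s)) ^ n * l ^ (-s) := by
      rw [← Real.rpow_natCast, ← Real.rpow_natCast, ← Real.rpow_mul h0.le, ← Real.rpow_mul h0.le,
        ← Real.rpow_add h0]
      congr 1; push_cast; ring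
    rw [this, hκ, mul_pow]; ring
  refine lt_of_le_of_lt (ENNReal.tsum_le_tsum hterm) ?_
  rw [← ENNReal.ofReal_tsum_of_nonneg (fun n => by positivity)
    ((summable_geometric_of_lt_one hκ0.le hκ1).mul_left _)]
  exact ENNReal.ofReal_lt_top

lemma cantor_exists {D : ℝ} (hD0 : 0 < D) (hD1 : D < 1) : ∃ T : ℝ → ℝ, Monotone T ∧ T 0 = 0 ∧
    T 1 = 1 / 4 ∧
    (∃ C : ℝ, 0 < C ∧ ∀ x h : ℝ, 0 < h →
      volume.real {t ∈ Icc (0:ℝ) 1 | |x - T t| ≤ h} ≤ C * h ^ D) ∧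
    volume {x : ℝ | infDist x (T '' Icc 0 1) = 0} = 0 ∧
    ∀ s, 0 < s → s < 1 - D →
      IntegrableOn (fun x => (infDist x (T '' Icc 0 1)) ^ (-s)) (Icc (-1) 1) := by
  set l : ℝ := (1 / 2) ^ (1 / D) with hl
  have h0 : 0 < l := by positivity
  have h1 : l < 1 / 2 := by
    have : (1 / 2 : ℝ) ^ (1 / D) < (1 / 2) ^ (1:ℝ) :=
      Real.rpow_lt_rpow_of_exponent_gt (by norm_num) (by norm_num) (by rw [lt_div_iff₀ hD0]; linarith)
    simpa [hl] using this
  have hlD : l ^ D = 1 / 2 := by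
    rw [hl, ← Real.rpow_mul (by norm_num), one_div_mul_cancel hD0.ne', Real.rpow_one]
  exact ⟨cT l, cT_mono h0 h1, cT_zero l, cT_one h0 h1, cT_frostman h0 h1 hD0 hlD, cT_null h0 h1,
    fun s hs hs' => cT_integrable h0 h1 hlD hs hs'⟩

end

section

/-! ## Distance functions and integrability -/

def rho (T : ℝ → ℝ) (x : ℝ) : ℝ := infDist x (T '' Icc 0 1)

structure IsCantor (n : ℝ) (T : ℝ → ℝ) : Prop where
  mono : Monotone T
  zero : T 0 = 0
  one : T 1 = 1 / 4
  frost : ∃ C : ℝ, 0 < C ∧ ∀ x h : ℝ, 0 < h →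
      volume.real {t ∈ Icc (0:ℝ) 1 | |x - T t| ≤ h} ≤ C * h ^ (1 - n)
  ae_pos : ∀ᵐ x : ℝ, 0 < rho T x
  integ : ∀ s, 0 < s → s < n → IntegrableOn (fun x => rho T x ^ (-s)) (Icc (-1) 1)

lemma exists_isCantor {n : ℝ} (h0 : 0 < n) (h1 : n < 1) : ∃ T, IsCantor n T := by
  obtain ⟨T, a, b, c, e, f, g⟩ := cantor_exists (D := 1 - n) (by linarith) (by linarith)
  refine ⟨T, a, b, c, e, ?_, fun s hs hs' => g s hs (by linarith)⟩
  rw [ae_iff]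
  refine measure_mono_null ?_ f
  intro x hx
  have hx' : ¬ 0 < rho T x := hx
  exact le_antisymm (not_lt.1 hx') infDist_nonneg

lemma rho_nonneg (T : ℝ → ℝ) (x : ℝ) : 0 ≤ rho T x := infDist_nonneg

lemma rho_lip (T : ℝ → ℝ) : LipschitzWith 1 (rho T) := lipschitz_infDist_pt _

lemma rho_sub_le (T : ℝ → ℝ) (x y : ℝ) : |rho T x - rho T y| ≤ |x - y| := by
  have := (rho_lip T).dist_le_mul x y
  simpa [Real.dist_eq] using this

lemma rho_cont (T : ℝ → ℝ) : Continuous (rho T) := (rho_lip T).continuous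

lemma rho_le (T : ℝ → ℝ) (x : ℝ) {t : ℝ} (ht : t ∈ Icc (0:ℝ) 1) : rho T x ≤ |x - T t| := by
  have := infDist_le_dist_of_mem (x := x) (mem_image_of_mem T ht)
  rwa [Real.dist_eq] at this

lemma IsCantor.mem {n : ℝ} {T : ℝ → ℝ} (h : IsCantor n T) {t : ℝ} (ht : t ∈ Icc (0:ℝ) 1) :
    T t ∈ Icc (0:ℝ) (1 / 4) := by
  constructor
  · rw [← h.zero]; exact h.mono ht.1
  · rw [← h.one]; exact h.mono ht.2

lemma IsCantor.rho_left {n : ℝ} {T : ℝ → ℝ} (h : IsCantor n T) : rho T (-1 / 4) = 1 / 4 := by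
  apply le_antisymm
  · have := rho_le T (-1 / 4) (t := 0) (by simp)
    rw [h.zero] at this
    refine this.trans_eq ?_
    norm_num [abs_of_neg]
  · refine (le_infDist (Set.Nonempty.image T ⟨0, by simp⟩)).2 ?_
    rintro _ ⟨t, ht, rfl⟩
    rw [Real.dist_eq]
    have := (h.mem ht).1
    rw [abs_sub_comm]
    exact le_trans (by linarith) (le_abs_self _)

lemma IsCantor.rho_right {n : ℝ} {T : ℝ → ℝ} (h : IsCantor n T) : rho T (1 / 2) = 1 / 4 := by
  apply le_antisymm
  · have := rho_le T (1 / 2) (t := 1) (by simp)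
    rw [h.one] at this
    refine this.trans_eq ?_
    norm_num [abs_of_pos]
  · refine (le_infDist (Set.Nonempty.image T ⟨0, by simp⟩)).2 ?_
    rintro _ ⟨t, ht, rfl⟩
    rw [Real.dist_eq]
    have := (h.mem ht).2
    exact le_trans (by linarith) (le_abs_self _)

lemma IsCantor.rho_le_quarter {n : ℝ} {T : ℝ → ℝ} (h : IsCantor n T) {x : ℝ}
    (hx : x ∈ Icc (-1 / 4 : ℝ) (1 / 2)) : rho T x ≤ 1 / 4 := by
  rcases le_total x (1 / 4) with h1 | h1
  · have := rho_le T x (t := 0) (by simp)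
    rw [h.zero] at this
    refine this.trans ?_
    rw [abs_le]; constructor <;> linarith [hx.1]
  · have := rho_le T x (t := 1) (by simp)
    rw [h.one] at this
    refine this.trans ?_
    rw [abs_le]; constructor <;> linarith [hx.2]

lemma ae_coord {d : ℕ} (i : Fin d) {P : ℝ → Prop} (h : ∀ᵐ x : ℝ, P x) :
    ∀ᵐ x : E d, P (x i) := by
  have h1 : Measure.QuasiMeasurePreserving (fun x : Fin d → ℝ => x i) volume volume :=
    Measure.quasiMeasurePreserving_eval (fun _ : Fin d => (volume : Measure ℝ)) i
  have h2 := h1.comp (EuclideanSpace.volume_preserving_symm_measurableEquiv_toLp (Fin d)).quasiMeasurePreserving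
  exact h2.ae h

variable {k : ℕ}

def rho1 (T : ℝ → ℝ) (x : E (k + 1)) : ℝ := ‖fun i : Fin k => rho T (x i.succ)‖

lemma rho1_nonneg (T : ℝ → ℝ) (x : E (k + 1)) : 0 ≤ rho1 T x := norm_nonneg _

lemma coord_sub_le {d : ℕ} (x y : E d) (i : Fin d) : |x i - y i| ≤ ‖x - y‖ := by
  have := PiLp.norm_apply_le (x - y) i
  simpa using this

lemma rho1_sub_le (T : ℝ → ℝ) (x y : E (k + 1)) : |rho1 T x - rho1 T y| ≤ ‖x - y‖ := by
  unfold rho1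
  refine (abs_norm_sub_norm_le _ _).trans ?_
  rw [pi_norm_le_iff_of_nonneg (norm_nonneg _)]
  intro i
  exact (rho_sub_le T _ _).trans (coord_sub_le x y i.succ)

lemma rho2_sub_le (T : ℝ → ℝ) (x y : E (k + 1)) : |rho T (x 0) - rho T (y 0)| ≤ ‖x - y‖ :=
  (rho_sub_le T _ _).trans (coord_sub_le x y 0)

lemma lipschitz_of_abs {d : ℕ} {f : E d → ℝ} {C : ℝ≥0}
    (h : ∀ x y, |f x - f y| ≤ C * ‖x - y‖) : LipschitzWith C f := by
  apply LipschitzWith.of_dist_le_mul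
  intro x y
  rw [Real.dist_eq, dist_eq_norm]; exact h x y

lemma rho1_cont (T : ℝ → ℝ) : Continuous (rho1 (k := k) T) :=
  (lipschitz_of_abs (C := 1) (fun x y => by simpa using rho1_sub_le T x y)).continuous

lemma rho_le_rho1 (T : ℝ → ℝ) (x : E (k + 1)) (i : Fin k) : rho T (x i.succ) ≤ rho1 T x := by
  have := norm_le_pi_norm (fun i : Fin k => rho T (x i.succ)) i
  rwa [Real.norm_of_nonneg (rho_nonneg _ _)] at this

def Psi (k : ℕ) (T1 T2 : ℝ → ℝ) (s σ : ℝ) (x : E (k + 1)) : ℝ :=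
  rho T2 (x 0) ^ (-s) * ∏ i : Fin k, rho T1 (x i.succ) ^ (-σ)

lemma Psi_nonneg (k : ℕ) (T1 T2 : ℝ → ℝ) (s σ : ℝ) (x : E (k + 1)) : 0 ≤ Psi k T1 T2 s σ x :=
  mul_nonneg (Real.rpow_nonneg (rho_nonneg _ _) _)
    (Finset.prod_nonneg fun _ _ => Real.rpow_nonneg (rho_nonneg _ _) _)

lemma Psi_integrable {T1 T2 : ℝ → ℝ} {n1 n2 s σ : ℝ} (h1 : IsCantor n1 T1) (h2 : IsCantor n2 T2)
    (hs : 0 < s) (hs' : s < n2) (hσ : 0 < σ) (hσ' : σ < n1) :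
    IntegrableOn (Psi k T1 T2 s σ) (cube (k + 1)) := by
  have hc : ∀ x ∈ cube (k + 1), ∀ i, x i ∈ Icc (-1:ℝ) 1 := fun x hx i =>
    ⟨(hx i).1.le, (hx i).2.le⟩
  set f : Fin (k + 1) → ℝ → ℝ := Fin.cons ((Icc (-1:ℝ) 1).indicator (fun x => rho T2 x ^ (-s)))
    (fun _ => (Icc (-1:ℝ) 1).indicator (fun x => rho T1 x ^ (-σ))) with hf
  have hIntg : ∀ i, Integrable (f i) := by
    intro i
    refine Fin.cases ?_ (fun j => ?_) i
    · simp only [hf, Fin.cons_zero]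
      exact (integrable_indicator_iff measurableSet_Icc).2 (h2.integ s hs hs')
    · simp only [hf, Fin.cons_succ]
      exact (integrable_indicator_iff measurableSet_Icc).2 (h1.integ σ hσ hσ')
  have hI : Integrable (fun x : Fin (k + 1) → ℝ => ∏ i, f i (x i)) := Integrable.fintype_prod hIntg
  have hI2 : Integrable (fun x : E (k + 1) => ∏ i, f i (x i)) :=
    (EuclideanSpace.volume_preserving_symm_measurableEquiv_toLp (Fin (k + 1))).integrable_comp_of_integrable hI
  refine (hI2.integrableOn (s := cube (k + 1))).congr_fun_ae ?_
  have hcm : MeasurableSet (cube (k + 1)) := by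
    have : cube (k + 1) = ⋂ i, (fun x : E (k + 1) => x i) ⁻¹' Ioo (-1) 1 := by
      ext x; simp [cube]
    rw [this]
    exact MeasurableSet.iInter fun i => (by fun_prop : Measurable fun x : E (k + 1) => x i) measurableSet_Ioo
  filter_upwards [ae_restrict_mem hcm] with x hx
  rw [Fin.prod_univ_succ, Psi]
  simp only [hf, Fin.cons_zero, Fin.cons_succ]
  rw [indicator_of_mem (hc x hx 0)]
  congr 1
  apply Finset.prod_congr rfl
  intro i _
  rw [indicator_of_mem (hc x hx i.succ)]

lemma cube_eq (d : ℕ) : cube d = ⋂ i, (fun x : E d => x i) ⁻¹' Ioo (-1) 1 := by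
  ext x; simp [cube]

lemma cube_open (d : ℕ) : IsOpen (cube d) := by
  rw [cube_eq]
  exact isOpen_iInter_of_finite fun i => isOpen_Ioo.preimage (by fun_prop)

lemma cube_meas (d : ℕ) : MeasurableSet (cube d) := (cube_open d).measurableSet

lemma cube_bounded (d : ℕ) : cube d ⊆ closedBall 0 (Real.sqrt d) := by
  intro x hx
  rw [mem_closedBall_zero_iff, EuclideanSpace.norm_eq]
  apply Real.sqrt_le_sqrt
  calc ∑ i, ‖x i‖ ^ 2 ≤ ∑ i : Fin d, (1:ℝ) := by
        apply Finset.sum_le_sum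
        intro i _
        have := hx i
        have h : |x i| ≤ 1 := abs_le.2 ⟨this.1.le, this.2.le⟩
        rw [Real.norm_eq_abs]
        nlinarith [abs_nonneg (x i)]
    _ = d := by simp

lemma cube_finite (d : ℕ) : volume (cube d) < ⊤ :=
  lt_of_le_of_lt (measure_mono (cube_bounded d)) measure_closedBall_lt_top

lemma rho1_rpow_le (hk : 0 < k) {T : ℝ → ℝ} {σ : ℝ} (hσ : 0 < σ) {x : E (k + 1)}
    (hx : ∀ i : Fin k, 0 < rho T (x i.succ)) :
    rho1 T x ^ (-σ) ≤ ∏ i : Fin k, rho T (x i.succ) ^ (-(σ / k)) := by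
  have hpos : 0 < rho1 T x := lt_of_lt_of_le (hx ⟨0, hk⟩) (rho_le_rho1 T x ⟨0, hk⟩)
  have hk' : (k:ℝ) ≠ 0 := by exact_mod_cast hk.ne'
  have : rho1 T x ^ (-σ) = ∏ i : Fin k, rho1 T x ^ (-(σ / k)) := by
    rw [Finset.prod_const, Finset.card_univ, Fintype.card_fin, ← Real.rpow_natCast,
      ← Real.rpow_mul hpos.le]
    congr 1; field_simp
  rw [this]
  apply Finset.prod_le_prod
  · intro i _; positivity
  · intro i _
    apply Real.rpow_le_rpow_of_nonpos (hx i) (rho_le_rho1 T x i)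
    have : 0 < σ / k := by positivity
    linarith

lemma rho1_pos (hk : 0 < k) {T : ℝ → ℝ} {x : E (k + 1)}
    (hx : ∀ i : Fin k, 0 < rho T (x i.succ)) : 0 < rho1 T x :=
  lt_of_lt_of_le (hx ⟨0, hk⟩) (rho_le_rho1 T x ⟨0, hk⟩)

lemma ae_rho_pos {T1 T2 : ℝ → ℝ} {n1 n2 : ℝ} (h1 : IsCantor n1 T1) (h2 : IsCantor n2 T2) :
    ∀ᵐ x : E (k + 1), 0 < rho T2 (x 0) ∧ ∀ i : Fin k, 0 < rho T1 (x i.succ) := by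
  have a := ae_coord (d := k + 1) 0 h2.ae_pos
  have b : ∀ᵐ x : E (k + 1), ∀ i : Fin k, 0 < rho T1 (x i.succ) :=
    ae_all_iff.2 fun i => ae_coord i.succ h1.ae_pos
  filter_upwards [a, b] with x hx hy using ⟨hx, hy⟩

end

section

/-! ## The conjugate function -/

lemma dp_nonneg {p q a t : ℝ} (hp : 0 < p) (hq : 0 < q) (ha : 0 ≤ a) (ht : 0 ≤ t) :
    0 ≤ doublePhase p q a t := by
  unfold doublePhase; positivity

lemma dp_zero {p q a : ℝ} (hp : 0 < p) (hq : 0 < q) : doublePhase p q a 0 = 0 := by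
  simp [doublePhase, Real.zero_rpow hp.ne', Real.zero_rpow hq.ne']

lemma young_p {p s t : ℝ} (hp : 1 < p) (ht : 0 ≤ t) :
    s * t ≤ |s| ^ (p / (p - 1)) + t ^ p / p := by
  have hpq := Real.HolderConjugate.conjExponent hp
  have h := Real.young_inequality s t hpq.symm
  rw [abs_of_nonneg ht] at h
  have h1 : 1 < Real.conjExponent p := hpq.symm.lt
  have h2 : |s| ^ Real.conjExponent p / Real.conjExponent p ≤ |s| ^ Real.conjExponent p :=
    div_le_self (by positivity) h1.le
  have : Real.conjExponent p = p / (p - 1) := rfl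
  rw [this] at h h2
  linarith

lemma conj_term_le_p {p q a s t : ℝ} (hp : 1 < p) (hq : 0 < q) (ha : 0 ≤ a) (ht : 0 ≤ t) :
    s * t - doublePhase p q a t ≤ |s| ^ (p / (p - 1)) := by
  have h := young_p (s := s) hp ht
  have : 0 ≤ a * t ^ q / q := by positivity
  unfold doublePhase; linarith

lemma conj_term_le_q {p q a s t : ℝ} (hp : 0 < p) (hq : 1 < q) (ha : 0 < a) (ht : 0 ≤ t)
    (hs : 0 ≤ s) :
    s * t - doublePhase p q a t ≤ s ^ (q / (q - 1)) * a ^ (-(1 / (q - 1))) := by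
  have h := young_p (s := s * a ^ (-(1 / q))) (t := a ^ (1 / q) * t) hq (by positivity)
  have e1 : s * a ^ (-(1 / q)) * (a ^ (1 / q) * t) = s * t := by
    rw [Real.rpow_neg ha.le]
    have : a ^ (1 / q) ≠ 0 := by positivity
    field_simp
  have hq0 : q - 1 ≠ 0 := by linarith
  have hq1 : q ≠ 0 := by linarith
  have e2 : |s * a ^ (-(1 / q))| ^ (q / (q - 1)) = s ^ (q / (q - 1)) * a ^ (-(1 / (q - 1))) := by
    rw [abs_of_nonneg (by positivity), Real.mul_rpow hs (by positivity), ← Real.rpow_mul ha.le]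
    congr 2; field_simp
  have e3 : (a ^ (1 / q) * t) ^ q = a * t ^ q := by
    rw [Real.mul_rpow (by positivity) ht, ← Real.rpow_mul ha.le, one_div_mul_cancel hq1,
      Real.rpow_one]
  rw [e1, e2, e3] at h
  have : 0 ≤ t ^ p / p := by positivity
  unfold doublePhase; linarith

lemma conj_nonneg {p q a s : ℝ} (hp : 1 < p) (hq : 0 < q) (ha : 0 ≤ a) :
    0 ≤ conjFn (doublePhase p q a) s := by
  unfold conjFn
  have hb : BddAbove (range fun t : ℝ≥0 => s * t - doublePhase p q a t) :=
    ⟨|s| ^ (p / (p - 1)), by rintro _ ⟨t, rfl⟩; exact conj_term_le_p hp hq ha t.2⟩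
  refine le_trans ?_ (le_ciSup hb 0)
  simp [dp_zero (by linarith : 0 < p) hq]

lemma conj_le_p {p q a s : ℝ} (hp : 1 < p) (hq : 0 < q) (ha : 0 ≤ a) (hs : 0 ≤ s) :
    conjFn (doublePhase p q a) s ≤ s ^ (p / (p - 1)) := by
  unfold conjFn
  apply ciSup_le
  intro t
  have := conj_term_le_p (s := s) hp hq ha t.2
  rwa [abs_of_nonneg hs] at this

lemma conj_le_q {p q a s : ℝ} (hp : 0 < p) (hq : 1 < q) (ha : 0 < a) (hs : 0 ≤ s) :
    conjFn (doublePhase p q a) s ≤ s ^ (q / (q - 1)) * a ^ (-(1 / (q - 1))) := by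
  unfold conjFn
  apply ciSup_le
  intro t
  exact conj_term_le_q hp hq ha t.2 hs

lemma conj_measurable {X : Type*} [MeasurableSpace X] {p q : ℝ} (hp : 1 < p) (hq : 0 < q)
    {f g : X → ℝ} (hf : Measurable f) (hg : Measurable g) (hf0 : ∀ x, 0 ≤ f x) :
    Measurable (fun x => conjFn (doublePhase p q (f x)) (g x)) := by
  have h : LowerSemicontinuous (fun y : ℝ × ℝ => ⨆ t : ℝ≥0, (y.2 * t - doublePhase p q (max y.1 0) t)) := by
    apply lowerSemicontinuous_ciSup
    · intro y
      refine ⟨|y.2| ^ (p / (p - 1)), ?_⟩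
      rintro _ ⟨t, rfl⟩
      exact conj_term_le_p hp hq (le_max_right _ _) t.2
    · intro t
      apply Continuous.lowerSemicontinuous
      unfold doublePhase
      fun_prop
  have h2 := h.measurable.comp (hf.prodMk hg)
  convert h2 using 1
  ext x
  simp [conjFn, max_eq_left (hf0 x)]

end

section

/-! ## Splitting off the vertical coordinate -/

variable {k : ℕ}

abbrev Y (k : ℕ) := Fin k → ℝ

def pt (h : ℝ) (y : Y k) : E (k + 1) := WithLp.toLp 2 (Fin.cons h y : Fin (k + 1) → ℝ)

@[simp] lemma pt_zero (h : ℝ) (y : Y k) : pt h y 0 = h := rfl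
@[simp] lemma pt_succ (h : ℝ) (y : Y k) (i : Fin k) : pt h y i.succ = y i := rfl

def hor (x : E (k + 1)) : Y k := fun i => x i.succ

@[simp] lemma hor_pt (h : ℝ) (y : Y k) : hor (pt h y) = y := rfl

lemma pt_hor (x : E (k + 1)) : pt (x 0) (hor x) = x := by
  ext i; refine Fin.cases ?_ (fun j => ?_) i <;> rfl

lemma hor_cont : Continuous (hor (k := k)) := by
  unfold hor; fun_prop

lemma pt_cont : Continuous (fun z : ℝ × Y k => pt z.1 z.2) := by
  unfold pt
  apply (PiLp.continuous_toLp 2 _).comp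
  apply continuous_pi
  intro i
  refine Fin.cases ?_ (fun j => ?_) i
  · exact continuous_fst
  · exact (continuous_apply j).comp continuous_snd

lemma pt_cont' {X : Type*} [TopologicalSpace X] {f : X → ℝ} {g : X → Y k} (hf : Continuous f)
    (hg : Continuous g) : Continuous fun x => pt (f x) (g x) := pt_cont.comp (hf.prodMk hg)

lemma pt_meas' {X : Type*} [MeasurableSpace X] {f : X → ℝ} {g : X → Y k} (hf : Measurable f)
    (hg : Measurable g) : Measurable fun x => pt (f x) (g x) :=
  pt_cont.measurable.comp (hf.prodMk hg)

def ptEquiv (k : ℕ) : (ℝ × Y k) ≃ᵐ E (k + 1) :=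
  (MeasurableEquiv.piFinSuccAbove (fun _ : Fin (k + 1) => ℝ) 0).symm.trans
    (MeasurableEquiv.toLp 2 (Fin (k + 1) → ℝ))

lemma ptEquiv_apply (z : ℝ × Y k) : ptEquiv k z = pt z.1 z.2 := by
  ext i
  refine Fin.cases ?_ (fun j => ?_) i <;> rfl

lemma pt_mp : MeasurePreserving (ptEquiv k) volume volume :=
  (EuclideanSpace.volume_preserving_symm_measurableEquiv_toLp (Fin (k + 1))).symm.comp
    (volume_preserving_piFinSuccAbove (fun _ : Fin (k + 1) => ℝ) 0).symm

lemma integral_pt {F : Type*} [NormedAddCommGroup F] [NormedSpace ℝ F] (f : E (k + 1) → F) :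
    ∫ x, f x = ∫ z : ℝ × Y k, f (pt z.1 z.2) := by
  rw [← pt_mp.integral_comp']
  simp only [ptEquiv_apply]

lemma integrable_pt {F : Type*} [NormedAddCommGroup F] [NormedSpace ℝ F] {f : E (k + 1) → F}
    (hf : Integrable f) : Integrable (fun z : ℝ × Y k => f (pt z.1 z.2)) := by
  have := pt_mp.integrable_comp_of_integrable hf
  simpa only [Function.comp_def, ptEquiv_apply] using this

lemma integrable_pt_iff {F : Type*} [NormedAddCommGroup F] [NormedSpace ℝ F] {f : E (k + 1) → F} :
    Integrable (fun z : ℝ × Y k => f (pt z.1 z.2)) ↔ Integrable f := by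
  have := pt_mp.integrable_comp_emb (ptEquiv k).measurableEmbedding (g := f)
  simpa only [Function.comp_def, ptEquiv_apply] using this

lemma ae_pt {P : E (k + 1) → Prop} (h : ∀ᵐ x, P x) :
    ∀ᵐ y : Y k, ∀ᵐ t : ℝ, P (pt t y) := by
  have h1 : ∀ᵐ z : ℝ × Y k, P (pt z.1 z.2) := by
    have := pt_mp.quasiMeasurePreserving.ae h
    simpa only [ptEquiv_apply] using this
  have h2 : ∀ᵐ z : Y k × ℝ, P (pt z.2 z.1) :=
    (Measure.measurePreserving_swap (μ := (volume : Measure (Y k))) (ν := (volume : Measure ℝ))).quasiMeasurePreserving.ae h1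
  exact Measure.ae_ae_of_ae_prod h2

lemma norm_pt_le (h : ℝ) (y : Y k) : ‖pt h y‖ ≤ |h| + k * ‖y‖ := by
  have h1 : pt h y = EuclideanSpace.single 0 h + ∑ i : Fin k, EuclideanSpace.single i.succ (y i) := by
    ext j
    refine Fin.cases ?_ (fun j => ?_) j
    · simp [Fin.succ_ne_zero, (Fin.succ_ne_zero _).symm]
    · simp only [pt_succ, PiLp.add_apply, WithLp.ofLp_sum, Finset.sum_apply, PiLp.single_apply, Fin.succ_inj]
      simp [Fin.succ_ne_zero]
  rw [h1]
  refine (norm_add_le _ _).trans ?_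
  refine add_le_add (by simp) ((norm_sum_le _ _).trans ?_)
  calc ∑ i : Fin k, ‖(EuclideanSpace.single i.succ (y i) : E (k + 1))‖ ≤ ∑ i : Fin k, ‖y‖ := by
        apply Finset.sum_le_sum; intro i _; simpa using norm_le_pi_norm y i
    _ = _ := by simp

lemma pt_sub (h h' : ℝ) (y y' : Y k) : pt h y - pt h' y' = pt (h - h') (y - y') := by
  ext i; refine Fin.cases ?_ (fun j => ?_) i <;> rfl

end

section

/-! ## The field -/

variable {k : ℕ}

def II : Set ℝ := Icc (-1 / 4) (1 / 2)

structure IsRad (r : ℝ → ℝ) : Prop where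
  lip : LipschitzWith 1 r
  nonneg : ∀ h, 0 ≤ r h
  pos : ∀ᵐ h, 0 < r h
  le : ∀ h ∈ II, r h ≤ 1 / 4
  left : r (-1 / 4) = 1 / 4
  right : r (1 / 2) = 1 / 4

lemma isRad_rho {n : ℝ} {T : ℝ → ℝ} (h : IsCantor n T) : IsRad (rho T) :=
  ⟨rho_lip T, rho_nonneg T, h.ae_pos, fun _ hx => h.rho_le_quarter hx, h.rho_left, h.rho_right⟩

lemma isRad_const : IsRad (fun _ => 1 / 4) :=
  ⟨LipschitzWith.const' _ |>.weaken zero_le_one, fun _ => by norm_num, by simp,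
    fun _ _ => le_rfl, rfl, rfl⟩

lemma IsRad.abs_deriv {r : ℝ → ℝ} (hr : IsRad r) (h : ℝ) : |deriv r h| ≤ 1 := by
  have := norm_deriv_le_of_lipschitz (x₀ := h) hr.lip
  simpa using this

def TT (T : ℝ → ℝ) (t : Y k) : Y k := fun i => T (t i)

def QQ (k : ℕ) : Set (Y k) := Icc 0 1

lemma mem_QQ {t : Y k} : t ∈ QQ k ↔ ∀ i, t i ∈ Icc (0:ℝ) 1 := by
  simp only [QQ, mem_Icc, Pi.le_def, Pi.zero_apply, Pi.one_apply]
  exact ⟨fun h i => ⟨h.1 i, h.2 i⟩, fun h => ⟨fun i => (h i).1, fun i => (h i).2⟩⟩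

lemma QQ_meas : MeasurableSet (QQ k) := measurableSet_Icc

lemma QQ_vol : volume (QQ k) = 1 := by
  rw [QQ, Real.volume_Icc_pi]; simp

instance : IsFiniteMeasure (volume.restrict (QQ k)) := ⟨by simp [QQ_vol]⟩

def kern (T : ℝ → ℝ) (r : ℝ → ℝ) (h : ℝ) (y t : Y k) : ℝ :=
  if ‖y - TT T t‖ ≤ r h / 2 then (r h ^ k)⁻¹ else 0

def dir (T : ℝ → ℝ) (r : ℝ → ℝ) (h : ℝ) (y t : Y k) : E (k + 1) :=
  pt 1 ((deriv r h * (r h)⁻¹) • (y - TT T t))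

open Classical in
def bfield (T : ℝ → ℝ) (r : ℝ → ℝ) (x : E (k + 1)) : E (k + 1) :=
  if x 0 ∈ II then ∫ t in QQ k, kern T r (x 0) (hor x) t • dir T r (x 0) (hor x) t else 0

lemma TT_meas {T : ℝ → ℝ} (hT : Monotone T) : Measurable (TT (k := k) T) :=
  measurable_pi_lambda _ fun i => hT.measurable.comp (measurable_pi_apply i)

lemma kern_meas {T r : ℝ → ℝ} (hT : Monotone T) (hr : Continuous r) :
    Measurable (fun z : (ℝ × Y k) × Y k => kern T r z.1.1 z.1.2 z.2) := by
  unfold kern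
  have := TT_meas (k := k) hT
  have hr := hr.measurable
  refine Measurable.ite (measurableSet_le ?_ ?_) ?_ measurable_const <;> fun_prop

lemma dir_meas {T r : ℝ → ℝ} (hT : Monotone T) (hr : Continuous r) :
    Measurable (fun z : (ℝ × Y k) × Y k => dir T r z.1.1 z.1.2 z.2) := by
  unfold dir
  have := TT_meas (k := k) hT
  have hr' := measurable_deriv r
  have hr := hr.measurable
  apply pt_meas'
  · fun_prop
  · fun_prop

lemma kd_meas {T r : ℝ → ℝ} (hT : Monotone T) (hr : Continuous r) :
    Measurable (fun z : (ℝ × Y k) × Y k =>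
      kern T r z.1.1 z.1.2 z.2 • dir T r z.1.1 z.1.2 z.2) :=
  (kern_meas hT hr).smul (dir_meas hT hr)

lemma bfield_meas {T r : ℝ → ℝ} (hT : Monotone T) (hr : Continuous r) :
    Measurable (bfield (k := k) T r) := by
  unfold bfield
  refine Measurable.ite ?_ ?_ measurable_const
  · exact (by fun_prop : Measurable fun x : E (k + 1) => x 0) measurableSet_Icc
  · have h := (kd_meas (k := k) hT hr).stronglyMeasurable.integral_prod_right'
      (ν := volume.restrict (QQ k))
    have h3 : Measurable (fun x : E (k + 1) => (x 0, hor x)) :=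
      (by fun_prop : Measurable fun x : E (k + 1) => x 0).prodMk hor_cont.measurable
    have h4 := h.measurable.comp h3
    simpa only [Function.comp_def] using h4

lemma kern_nonneg {T r : ℝ → ℝ} (hr : IsRad r) (h : ℝ) (y t : Y k) : 0 ≤ kern T r h y t := by
  unfold kern
  have := hr.nonneg h
  split_ifs <;> positivity

lemma kd_norm {T r : ℝ → ℝ} (hr : IsRad r) (h : ℝ) (y t : Y k) :
    ‖kern T r h y t • dir T r h y t‖ ≤ kern T r h y t * (1 + k) := by
  rw [norm_smul, Real.norm_of_nonneg (kern_nonneg hr h y t)]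
  by_cases hc : ‖y - TT T t‖ ≤ r h / 2
  · apply mul_le_mul_of_nonneg_left _ (kern_nonneg hr h y t)
    refine (norm_pt_le _ _).trans ?_
    rw [abs_one]
    have : ‖(deriv r h * (r h)⁻¹) • (y - TT T t)‖ ≤ 1 := by
      rw [norm_smul, norm_mul, Real.norm_eq_abs, norm_inv, Real.norm_of_nonneg (hr.nonneg h)]
      rcases (hr.nonneg h).eq_or_lt with h0 | h0
      · rw [← h0]; simp
      · calc |deriv r h| * (r h)⁻¹ * ‖y - TT T t‖ ≤ 1 * (r h)⁻¹ * (r h / 2) := by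
              gcongr; exact hr.abs_deriv h
          _ = 1 / 2 := by field_simp
          _ ≤ 1 := by norm_num
    nlinarith [(Nat.cast_nonneg k : (0:ℝ) ≤ k)]
  · simp [kern, hc]

lemma kern_bound {T r : ℝ → ℝ} (hr : IsRad r) (h : ℝ) (y t : Y k) :
    kern T r h y t ≤ (r h ^ k)⁻¹ := by
  unfold kern
  have := hr.nonneg h
  split_ifs
  · exact le_rfl
  · positivity

lemma kern_int_le {T r : ℝ → ℝ} {n : ℝ} (hT : IsCantor n T) :
    ∃ C : ℝ, 0 < C ∧ ∀ r : ℝ → ℝ, IsRad r → ∀ (h : ℝ) (y : Y k), 0 < r h →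
      ∫ t in QQ k, kern T r h y t ≤ C * r h ^ (-(k * n)) := by
  obtain ⟨C, hC, hf⟩ := hT.frost
  refine ⟨C ^ k, by positivity, fun r hr h y hpos => ?_⟩
  have hTm : Measurable T := hT.mono.measurable
  set S : Set (Y k) := univ.pi fun i => {t ∈ Icc (0:ℝ) 1 | |y i - T t| ≤ r h / 2} with hS
  have hSm : MeasurableSet S := by
    refine MeasurableSet.univ_pi fun i => ?_
    exact measurableSet_Icc.inter (measurableSet_le (f := fun t => |y i - T t|) (by fun_prop) measurable_const)
  have h1 : ∫ t in QQ k, kern T r h y t = ∫ t, S.indicator (fun _ => (r h ^ k)⁻¹) t := by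
    rw [← integral_indicator QQ_meas]
    congr 1; ext t
    have : t ∈ S ↔ t ∈ QQ k ∧ ‖y - TT T t‖ ≤ r h / 2 := by
      rw [mem_QQ, pi_norm_le_iff_of_nonneg (by positivity), hS, Set.mem_univ_pi]
      exact ⟨fun h => ⟨fun i => (h i).1, fun i => (h i).2⟩, fun h i => ⟨h.1 i, h.2 i⟩⟩
    by_cases h1 : t ∈ QQ k <;> by_cases h2 : ‖y - TT T t‖ ≤ r h / 2 <;>
      simp [indicator, this, kern, h1, h2]
  rw [h1, integral_indicator hSm, setIntegral_const]
  have h2 : volume.real S ≤ ∏ i : Fin k, (C * r h ^ (1 - n)) := by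
    rw [measureReal_def, hS, volume_pi_pi, ENNReal.toReal_prod]
    apply Finset.prod_le_prod
    · intros; positivity
    · intro i _
      have h3 := hf (y i) (r h) hpos
      refine le_trans ?_ h3
      apply measureReal_mono
      · intro t ht
        exact ⟨ht.1, ht.2.trans (by linarith)⟩
      · exact (lt_of_le_of_lt (measure_mono (fun t ht => ht.1)) (measure_Icc_lt_top (a := (0:ℝ)) (b := 1))).ne
  rw [smul_eq_mul]
  calc volume.real S * (r h ^ k)⁻¹ ≤ (∏ i : Fin k, (C * r h ^ (1 - n))) * (r h ^ k)⁻¹ := by gcongr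
    _ = C ^ k * r h ^ (-(k * n)) := by
      rw [Finset.prod_const, Finset.card_univ, Fintype.card_fin, mul_pow, mul_assoc]
      congr 1
      rw [← Real.rpow_natCast, ← Real.rpow_natCast, ← Real.rpow_mul hpos.le, ← Real.rpow_neg hpos.le,
        ← Real.rpow_add hpos]
      congr 1; ring

lemma kern_integrable {T r : ℝ → ℝ} (hT : Monotone T) (hr : IsRad r) (h : ℝ) (y : Y k) :
    IntegrableOn (fun t => kern T r h y t) (QQ k) := by
  refine Integrable.of_bound (C := (r h ^ k)⁻¹) ?_ ?_
  · have := (kern_meas (k := k) hT hr.lip.continuous).comp (measurable_prodMk_left (x := (h, y)))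
    exact this.aestronglyMeasurable
  · refine ae_of_all _ fun t => ?_
    rw [Real.norm_of_nonneg (kern_nonneg hr h y t)]
    exact kern_bound hr h y t

lemma kd_integrable {T r : ℝ → ℝ} (hT : Monotone T) (hr : IsRad r) (h : ℝ) (y : Y k) :
    IntegrableOn (fun t => kern T r h y t • dir T r h y t) (QQ k) := by
  refine Integrable.mono' ((kern_integrable hT hr h y).mul_const (1 + k : ℝ)) ?_ ?_
  · have := (kd_meas (k := k) hT hr.lip.continuous).comp (measurable_prodMk_left (x := (h, y)))
    exact this.aestronglyMeasurable
  · exact ae_of_all _ fun t => kd_norm hr h y t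

lemma bfield_bound {T : ℝ → ℝ} {n : ℝ} (hT : IsCantor n T) :
    ∃ C : ℝ, 0 < C ∧ ∀ r : ℝ → ℝ, IsRad r → ∀ x : E (k + 1), 0 < r (x 0) →
      ‖bfield T r x‖ ≤ C * r (x 0) ^ (-(k * n)) := by
  obtain ⟨C, hC, h⟩ := kern_int_le (k := k) (r := fun _ => 0) hT
  refine ⟨C * (1 + k), by positivity, fun r hr x hx => ?_⟩
  unfold bfield
  split_ifs with hI
  · refine (norm_integral_le_of_norm_le ((kern_integrable hT.mono hr _ _).mul_const (1 + k : ℝ))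
      (ae_of_all _ fun t => kd_norm hr _ _ t)).trans ?_
    rw [integral_mul_const]
    have := h r hr (x 0) (hor x) hx
    calc _ ≤ (C * r (x 0) ^ (-(k * n))) * (1 + k : ℝ) := by gcongr
      _ = _ := by ring
  · simp; positivity

lemma kern_eq_zero {T r : ℝ → ℝ} {x : E (k + 1)} {t : Y k} (ht : t ∈ QQ k)
    (h : r (x 0) / 2 < rho1 T x) : kern T r (x 0) (hor x) t = 0 := by
  unfold kern
  rw [if_neg]
  intro hc
  have : rho1 T x ≤ ‖hor x - TT T t‖ := by
    unfold rho1
    rw [pi_norm_le_iff_of_nonneg (norm_nonneg _)]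
    intro i
    rw [Real.norm_of_nonneg (rho_nonneg _ _)]
    refine (rho_le T _ (mem_QQ.1 ht i)).trans ?_
    exact norm_le_pi_norm (hor x - TT T t) i
  linarith

lemma bfield_eq_zero {T r : ℝ → ℝ} {x : E (k + 1)}
    (h : r (x 0) / 2 < rho1 T x) : bfield T r x = 0 := by
  unfold bfield
  split_ifs
  · rw [setIntegral_congr_fun (g := fun _ => 0) QQ_meas]
    · simp
    · intro t ht
      simp [kern_eq_zero ht h]
  · rfl

def KK (k : ℕ) : Set (E (k + 1)) := {x | ∀ i, x i ∈ Icc (-1 / 2 : ℝ) (1 / 2)}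

lemma TT_mem {T : ℝ → ℝ} {n : ℝ} (hT : IsCantor n T) {t : Y k} (ht : t ∈ QQ k) (i : Fin k) :
    TT T t i ∈ Icc (0:ℝ) (1 / 4) := hT.mem (mem_QQ.1 ht i)

lemma hor_mem {T : ℝ → ℝ} {n : ℝ} (hT : IsCantor n T) {t : Y k} (ht : t ∈ QQ k)
    {y : Y k} {s : ℝ} (hs : s ≤ 1 / 4) (hy : ‖y - TT T t‖ ≤ s / 2) (i : Fin k) :
    y i ∈ Icc (-1 / 8 : ℝ) (3 / 8) := by
  have h1 := (norm_le_pi_norm (y - TT T t) i).trans hy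
  have h2 := TT_mem hT ht i
  rw [Pi.sub_apply, Real.norm_eq_abs, abs_le] at h1
  exact ⟨by linarith [h1.1, h2.1], by linarith [h1.2, h2.2]⟩

lemma pt_mem_KK {T : ℝ → ℝ} {n : ℝ} (hT : IsCantor n T) {t : Y k} (ht : t ∈ QQ k)
    {y : Y k} {s h : ℝ} (hh : h ∈ II) (hs : s ≤ 1 / 4) (hy : ‖y - TT T t‖ ≤ s / 2) :
    pt h y ∈ KK k := by
  intro i
  refine Fin.cases ?_ (fun j => ?_) i
  · exact ⟨by rw [pt_zero]; linarith [hh.1], hh.2⟩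
  · have := hor_mem hT ht hs hy j
    exact ⟨by rw [pt_succ]; linarith [this.1], by rw [pt_succ]; linarith [this.2]⟩

lemma bfield_support {T r : ℝ → ℝ} {n : ℝ} (hT : IsCantor n T) (hr : IsRad r) {x : E (k + 1)}
    (hx : x ∉ KK k) : bfield T r x = 0 := by
  unfold bfield
  split_ifs with hI
  · rw [setIntegral_congr_fun (g := fun _ => 0) QQ_meas]
    · simp
    · intro t ht
      have : kern T r (x 0) (hor x) t = 0 := by
        unfold kern
        rw [if_neg]
        intro hc
        apply hx
        have := pt_mem_KK hT ht hI (hr.le _ hI) hc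
        rwa [pt_hor] at this
      simp [this]
  · rfl

lemma KK_closed : IsClosed (KK k) := by
  have : KK k = ⋂ i, (fun x : E (k + 1) => x i) ⁻¹' Icc (-1 / 2) (1 / 2) := by
    ext x; simp [KK]
  rw [this]
  exact isClosed_iInter fun i => isClosed_Icc.preimage (by fun_prop)

lemma KK_sub : KK k ⊆ cube (k + 1) := fun x hx i =>
  ⟨by linarith [(hx i).1], by linarith [(hx i).2]⟩

lemma KK_compact : IsCompact (KK k) :=
  (isCompact_closedBall _ _).of_isClosed_subset KK_closed (KK_sub.trans (cube_bounded _))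

lemma KK_convex : Convex ℝ (KK k) := by
  intro x hx y hy a b ha hb hab i
  exact (convex_Icc (-1 / 2 : ℝ) (1 / 2)) (hx i) (hy i) ha hb hab

end

section

/-! ## Integral formula for the field -/

variable {k : ℕ}

def ZZ (k : ℕ) : Set (Y k) := closedBall 0 (1 / 2)

lemma ZZ_meas : MeasurableSet (ZZ k) := measurableSet_closedBall

instance : IsFiniteMeasure (volume.restrict (ZZ k)) :=
  ⟨by simp [ZZ]⟩

/-- parameter measure -/
def nuu (k : ℕ) : Measure (Y k × Y k) := (volume.restrict (QQ k)).prod (volume.restrict (ZZ k))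

instance : IsFiniteMeasure (nuu k) := by unfold nuu; infer_instance

lemma nuu_ae : ∀ᵐ p ∂(nuu k), p.1 ∈ QQ k ∧ p.2 ∈ ZZ k := by
  have h1 : ∀ᵐ p ∂(nuu k), p.1 ∈ QQ k :=
    Measure.quasiMeasurePreserving_fst.ae (ae_restrict_mem QQ_meas)
  have h2 : ∀ᵐ p ∂(nuu k), p.2 ∈ ZZ k :=
    Measure.quasiMeasurePreserving_snd.ae (ae_restrict_mem ZZ_meas)
  filter_upwards [h1, h2] with p a b using ⟨a, b⟩

/-- the integrand along a curve -/
def crv (T r : ℝ → ℝ) (F : E (k + 1) → E (k + 1)) (h : ℝ) (p : Y k × Y k) : ℝ :=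
  ⟪pt 1 (deriv r h • p.2), F (pt h (TT T p.1 + r h • p.2))⟫

lemma crv_meas {T r : ℝ → ℝ} (hT : Monotone T) (hr : Continuous r) {F : E (k + 1) → E (k + 1)}
    (hF : Measurable F) : Measurable (fun z : ℝ × (Y k × Y k) => crv T r F z.1 z.2) := by
  have hTm := TT_meas (k := k) hT
  have hr' := measurable_deriv r
  have hr := hr.measurable
  unfold crv
  apply Measurable.inner
  · apply pt_meas' <;> fun_prop
  · apply hF.comp
    apply pt_meas' <;> fun_prop

lemma crv_bound {T r : ℝ → ℝ} (hr : IsRad r) {F : E (k + 1) → E (k + 1)} {CF : ℝ}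
    (hF : ∀ x, ‖F x‖ ≤ CF) (h : ℝ) {p : Y k × Y k} (hp : p.2 ∈ ZZ k) :
    ‖crv T r F h p‖ ≤ (1 + k) * CF := by
  have h0 : 0 ≤ CF := (norm_nonneg _).trans (hF 0)
  unfold crv
  refine (norm_inner_le_norm _ _).trans ?_
  apply mul_le_mul _ (hF _) (norm_nonneg _) (by positivity)
  refine (norm_pt_le _ _).trans ?_
  rw [abs_one]
  have h1 : ‖deriv r h • p.2‖ ≤ 1 := by
    rw [norm_smul, Real.norm_eq_abs]
    have h2 : ‖p.2‖ ≤ 1 / 2 := by simpa [ZZ] using hp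
    have h3 := hr.abs_deriv h
    nlinarith [norm_nonneg p.2, abs_nonneg (deriv r h)]
  nlinarith [(Nat.cast_nonneg k : (0:ℝ) ≤ k)]

lemma kern_subst {T r : ℝ → ℝ} {h : ℝ} (hpos : 0 < r h) (F : E (k + 1) → E (k + 1)) (t : Y k) :
    ∫ y : Y k, kern T r h y t * ⟪dir T r h y t, F (pt h y)⟫ = ∫ z in ZZ k, crv T r F h (t, z) := by
  set G : Y k → ℝ := (ZZ k).indicator (fun z => crv T r F h (t, z)) with hG
  have h1 : ∀ y : Y k, kern T r h y t * ⟪dir T r h y t, F (pt h y)⟫ =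
      (r h ^ k)⁻¹ * G ((r h)⁻¹ • (y - TT T t)) := by
    intro y
    have e : (r h)⁻¹ • (y - TT T t) ∈ ZZ k ↔ ‖y - TT T t‖ ≤ r h / 2 := by
      rw [ZZ, mem_closedBall_zero_iff, norm_smul, norm_inv, Real.norm_of_nonneg hpos.le,
        inv_mul_le_iff₀ hpos]
      rw [mul_one_div]
    unfold kern
    by_cases hc : ‖y - TT T t‖ ≤ r h / 2
    · rw [if_pos hc, hG, indicator_of_mem (e.2 hc)]
      congr 1
      unfold crv dir
      simp only [smul_smul]
      rw [mul_inv_cancel₀ hpos.ne', one_smul]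
      congr 3
      abel
    · rw [if_neg hc, hG, indicator_of_notMem (fun h => hc (e.1 h))]
      simp
  simp_rw [h1]
  rw [integral_const_mul, integral_sub_right_eq_self (fun y => G ((r h)⁻¹ • y)),
    Measure.integral_comp_smul, hG, integral_indicator ZZ_meas]
  simp only [Module.finrank_fintype_fun_eq_card, Fintype.card_fin, smul_eq_mul]
  rw [abs_of_pos (by positivity), inv_pow, inv_inv, ← mul_assoc, inv_mul_cancel₀ (by positivity), one_mul]

lemma slice_formula {T r : ℝ → ℝ} {n : ℝ} (hT : IsCantor n T) (hr : IsRad r) {h : ℝ}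
    (hpos : 0 < r h) (hh : h ∈ II) {F : E (k + 1) → E (k + 1)} (hF : Measurable F) {CF : ℝ}
    (hFb : ∀ x, ‖F x‖ ≤ CF) :
    ∫ y : Y k, ⟪bfield T r (pt h y), F (pt h y)⟫ = ∫ p, crv T r F h p ∂(nuu k) := by
  have h0 : 0 ≤ CF := (norm_nonneg _).trans (hFb 0)
  have e1 : ∀ y : Y k, ⟪bfield T r (pt h y), F (pt h y)⟫ =
      ∫ t in QQ k, kern T r h y t * ⟪dir T r h y t, F (pt h y)⟫ := by
    intro y
    unfold bfield
    rw [if_pos (by simpa using hh), real_inner_comm, pt_zero, hor_pt,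
      ← integral_inner (kd_integrable hT.mono hr h y)]
    congr 1; ext t
    rw [real_inner_comm, real_inner_smul_left]
  simp_rw [e1]
  rw [integral_integral_swap]
  · simp_rw [kern_subst hpos]
    rw [nuu, integral_prod]
    refine Integrable.of_bound (C := (1 + k) * CF) ?_ ?_
    · exact ((crv_meas hT.mono hr.lip.continuous hF).comp measurable_prodMk_left).aestronglyMeasurable
    · filter_upwards [nuu_ae] with p hp using crv_bound hr hFb h hp.2
  · have hm : Measurable (fun p : Y k × Y k => kern T r h p.1 p.2 *
        ⟪dir T r h p.1 p.2, F (pt h p.1)⟫) := by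
      have hi : Measurable (fun p : Y k × Y k => ((h, p.1), p.2)) := by fun_prop
      have hk := (kern_meas hT.mono hr.lip.continuous).comp hi
      have hd := (dir_meas hT.mono hr.lip.continuous).comp hi
      refine hk.mul (hd.inner (hF.comp (pt_meas' measurable_const measurable_fst)))
    have hfin : IntegrableOn (fun _ : Y k × Y k => (r h ^ k)⁻¹ * (1 + k) * CF)
        (closedBall (0 : Y k) 1 ×ˢ univ) ((volume : Measure (Y k)).prod (volume.restrict (QQ k))) := by
      apply integrableOn_const
      · rw [Measure.prod_prod]
        exact (ENNReal.mul_lt_top measure_closedBall_lt_top (measure_lt_top _ _)).ne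
      · exact enorm_ne_top
    refine Integrable.mono' ((integrable_indicator_iff
      (measurableSet_closedBall.prod MeasurableSet.univ)).2 hfin) hm.aestronglyMeasurable ?_
    have h2 : ∀ᵐ p ∂((volume : Measure (Y k)).prod (volume.restrict (QQ k))), p.2 ∈ QQ k :=
      Measure.quasiMeasurePreserving_snd.ae (ae_restrict_mem QQ_meas)
    filter_upwards [h2] with p hp
    simp only [Function.uncurry]
    by_cases hc : ‖p.1 - TT T p.2‖ ≤ r h / 2
    · have hmem : p ∈ closedBall (0 : Y k) 1 ×ˢ (univ : Set (Y k)) := by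
        refine ⟨?_, mem_univ _⟩
        rw [mem_closedBall_zero_iff, pi_norm_le_iff_of_nonneg zero_le_one]
        intro i
        have := hor_mem hT hp (hr.le h hh) hc i
        rw [Real.norm_eq_abs, abs_le]
        exact ⟨by linarith [this.1], by linarith [this.2]⟩
      rw [indicator_of_mem hmem]
      have h3 := kd_norm (T := T) hr h p.1 p.2
      have h4 := kern_bound (T := T) hr h p.1 p.2
      have h5 := kern_nonneg (T := T) hr h p.1 p.2
      rw [← real_inner_smul_left]
      refine (norm_inner_le_norm _ _).trans ?_
      refine mul_le_mul (h3.trans ?_) (hFb _) (norm_nonneg _) (by positivity)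
      gcongr
    · have : kern T r h p.1 p.2 = 0 := by simp [kern, hc]
      rw [this]
      simp only [zero_mul, norm_zero]
      exact indicator_nonneg (fun _ _ => by positivity) _

lemma field_formula {T r : ℝ → ℝ} {n : ℝ} (hT : IsCantor n T) (hr : IsRad r)
    (hb : Integrable (bfield (k := k) T r)) {F : E (k + 1) → E (k + 1)} (hF : Measurable F) {CF : ℝ}
    (hFb : ∀ x, ‖F x‖ ≤ CF) :
    ∫ x, ⟪bfield T r x, F x⟫ = ∫ p, (∫ h in II, crv T r F h p) ∂(nuu k) := by
  have hIntg : Integrable (fun x => ⟪bfield T r x, F x⟫) := by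
    refine Integrable.mono' (hb.norm.mul_const CF) ?_ ?_
    · exact ((bfield_meas hT.mono hr.lip.continuous).inner hF).aestronglyMeasurable
    · refine ae_of_all _ fun x => (norm_inner_le_norm _ _).trans ?_
      gcongr; exact hFb x
  rw [integral_pt, Measure.volume_eq_prod, integral_prod _ (by
    have := integrable_pt hIntg
    rwa [Measure.volume_eq_prod] at this)]
  have : ∀ᵐ h : ℝ, ∫ y : Y k, ⟪bfield T r (pt h y), F (pt h y)⟫ =
      II.indicator (fun h => ∫ p, crv T r F h p ∂(nuu k)) h := by
    filter_upwards [hr.pos] with h hpos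
    by_cases hh : h ∈ II
    · rw [indicator_of_mem hh, slice_formula hT hr hpos hh hF hFb]
    · rw [indicator_of_notMem hh]
      simp [bfield, hh]
  rw [integral_congr_ae this, integral_indicator (show MeasurableSet II from measurableSet_Icc), integral_integral_swap]
  haveI : IsFiniteMeasure ((volume : Measure ℝ).restrict II) := ⟨by simp [II]⟩
  refine Integrable.of_bound (C := (1 + k) * CF) ?_ ?_
  · exact (crv_meas hT.mono hr.lip.continuous hF).aestronglyMeasurable
  · have := (Measure.quasiMeasurePreserving_snd (μ := (volume : Measure ℝ).restrict II)).ae (nuu_ae (k := k))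
    filter_upwards [this] with p hp using crv_bound hr hFb _ hp.2

end

section

/-! ## The field is divergence free -/

variable {k : ℕ}

lemma ftc_II {f g : ℝ → ℝ} {C : ℝ≥0} (hf : LipschitzOnWith C f II)
    (hg : ∀ᵐ h, h ∈ Ioo (-1 / 4 : ℝ) (1 / 2) → deriv f h = g h) :
    ∫ h in II, g h = f (1 / 2) - f (-1 / 4) := by
  have hI : uIcc (-1 / 4 : ℝ) (1 / 2) = II := by rw [uIcc_of_le (by norm_num)]; rfl
  have h1 := (LipschitzOnWith.absolutelyContinuousOnInterval (a := -1 / 4) (b := 1 / 2) (f := f) (K := C)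
    (by rw [hI]; exact hf)).integral_deriv_eq_sub
  rw [← h1, intervalIntegral.integral_of_le (by norm_num), II, integral_Icc_eq_integral_Ioc,
    integral_Ioc_eq_integral_Ioo, integral_Ioc_eq_integral_Ioo]
  apply setIntegral_congr_ae measurableSet_Ioo
  filter_upwards [hg] with h hh hm using (hh hm).symm

lemma pt_lin (h s : ℝ) (c z : Y k) : pt h (c + s • z) = h • pt 1 0 + s • pt 0 z + pt 0 c := by
  ext i
  refine Fin.cases ?_ (fun j => ?_) i
  · simp
  · simp; ring

lemma pt_lin' (s : ℝ) (z : Y k) : pt 1 (s • z) = pt 1 0 + s • pt 0 z := by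
  ext i
  refine Fin.cases ?_ (fun j => ?_) i
  · simp
  · simp

lemma v_lip {v : E (k + 1) → ℝ} (hv : ContDiffOn ℝ (⊤ : ℕ∞) v (cube (k + 1))) :
    ∃ C : ℝ≥0, (∀ x ∈ KK k, ‖gradient v x‖ ≤ C) ∧ LipschitzOnWith C v (KK k) := by
  have h1 : ContinuousOn (fderiv ℝ v) (cube (k + 1)) :=
    hv.continuousOn_fderiv_of_isOpen (cube_open _) (by exact_mod_cast le_top)
  obtain ⟨C, hC⟩ := (KK_compact (k := k)).exists_bound_of_continuousOn (h1.mono KK_sub)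
  refine ⟨C.toNNReal, ?_, ?_⟩
  · intro x hx
    refine le_trans ?_ (Real.le_coe_toNNReal C)
    rw [gradient, LinearIsometryEquiv.norm_map]
    exact hC x hx
  · apply KK_convex.lipschitzOnWith_of_nnnorm_fderiv_le (𝕜 := ℝ)
    · intro x hx
      exact (hv.contDiffAt ((cube_open _).mem_nhds (KK_sub hx))).differentiableAt (by simp)
    · intro x hx
      rw [← NNReal.coe_le_coe]
      exact (hC x hx).trans (Real.le_coe_toNNReal C)

lemma curve_mem {T r : ℝ → ℝ} {n : ℝ} (hT : IsCantor n T) (hr : IsRad r) {p : Y k × Y k}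
    (hp : p.1 ∈ QQ k ∧ p.2 ∈ ZZ k) {h : ℝ} (hh : h ∈ II) :
    pt h (TT T p.1 + r h • p.2) ∈ KK k := by
  refine pt_mem_KK hT hp.1 hh (hr.le h hh) ?_
  have h2 : ‖p.2‖ ≤ 1 / 2 := by simpa [ZZ] using hp.2
  rw [add_sub_cancel_left, norm_smul, Real.norm_of_nonneg (hr.nonneg h)]
  nlinarith [hr.nonneg h]

lemma flow {T r : ℝ → ℝ} {n : ℝ} (hT : IsCantor n T) (hr : IsRad r) {v : E (k + 1) → ℝ}
    (hv : ContDiffOn ℝ (⊤ : ℕ∞) v (cube (k + 1))) {p : Y k × Y k}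
    (hp : p.1 ∈ QQ k ∧ p.2 ∈ ZZ k) :
    ∫ h in II, crv T r ((KK k).indicator (gradient v)) h p =
      v (pt (1 / 2) (TT T p.1 + (1 / 4 : ℝ) • p.2)) - v (pt (-1 / 4) (TT T p.1 + (1 / 4 : ℝ) • p.2)) := by
  obtain ⟨C, -, hC⟩ := v_lip hv
  set γ : ℝ → E (k + 1) := fun h => pt h (TT T p.1 + r h • p.2) with hγ
  have hγL : ∃ D : ℝ≥0, LipschitzWith D γ := by
    refine ⟨(1 + k * ‖p.2‖₊), LipschitzWith.of_dist_le_mul fun a b => ?_⟩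
    rw [dist_eq_norm, hγ]
    simp only
    rw [pt_sub]
    refine (norm_pt_le _ _).trans ?_
    rw [add_sub_add_left_eq_sub, ← sub_smul, norm_smul]
    have := hr.lip.dist_le_mul a b
    rw [dist_eq_norm, Real.dist_eq] at this
    rw [Real.dist_eq]
    push_cast
    have h1 : ‖r a - r b‖ ≤ |a - b| := by simpa using this
    have h2 : ‖r a - r b‖ * ‖p.2‖ ≤ |a - b| * ‖p.2‖ := by gcongr
    calc |a - b| + k * (‖r a - r b‖ * ‖p.2‖) ≤ |a - b| + k * (|a - b| * ‖p.2‖) := by gcongr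
      _ = _ := by ring
  obtain ⟨D, hD⟩ := hγL
  have hmaps : MapsTo γ II (KK k) := fun h hh => curve_mem hT hr hp hh
  have hL : LipschitzOnWith (C * D) (v ∘ γ) II := hC.comp hD.lipschitzOnWith hmaps
  rw [ftc_II (f := v ∘ γ) hL]
  · simp only [Function.comp, hγ, hr.left, hr.right]
  · filter_upwards [hr.lip.ae_differentiableAt_real] with h hd hh
    have hm : h ∈ II := ⟨hh.1.le, hh.2.le⟩
    have hg : HasDerivAt γ (pt 1 (deriv r h • p.2)) h := by
      have e : γ = fun h => h • pt 1 0 + r h • pt 0 p.2 + pt 0 (TT T p.1) := by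
        ext1 h; rw [hγ]; exact pt_lin _ _ _ _
      rw [e, pt_lin']
      have h1 := ((hasDerivAt_id h).smul_const (pt 1 0 : E (k + 1))).add
        (hd.hasDerivAt.smul_const (pt 0 p.2 : E (k + 1)))
      have h2 := h1.add_const (pt 0 (TT T p.1))
      simpa using h2
    have hvd : DifferentiableAt ℝ v (γ h) :=
      (hv.contDiffAt ((cube_open _).mem_nhds (KK_sub (hmaps hm)))).differentiableAt (by simp)
    have := hvd.hasFDerivAt.comp_hasDerivAt h hg
    rw [this.deriv, crv, indicator_of_mem (hmaps hm), real_inner_comm, gradient,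
      InnerProductSpace.toDual_symm_apply]

lemma gradient_meas_KK {v : E (k + 1) → ℝ} (hv : ContDiffOn ℝ (⊤ : ℕ∞) v (cube (k + 1))) :
    Measurable ((KK k).indicator (gradient v)) := by
  have : Measurable (fun x => gradient v x) := by
    unfold gradient
    exact (InnerProductSpace.toDual ℝ (E (k + 1))).symm.continuous.measurable.comp (measurable_fderiv ℝ v)
  exact this.indicator KK_closed.measurableSet

/-- the difference of the two fields is orthogonal to gradients -/
lemma field_div_free {T r s : ℝ → ℝ} {n : ℝ} (hT : IsCantor n T) (hr : IsRad r) (hs : IsRad s)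
    (hbr : Integrable (bfield (k := k) T r)) (hbs : Integrable (bfield (k := k) T s))
    {v : E (k + 1) → ℝ} (hv : ContDiffOn ℝ (⊤ : ℕ∞) v (cube (k + 1))) :
    ∫ x in cube (k + 1), ⟪bfield T r x - bfield T s x, gradient v x⟫ = 0 := by
  obtain ⟨C, hC, -⟩ := v_lip hv
  set F := (KK k).indicator (gradient v) with hF
  have hFm : Measurable F := gradient_meas_KK hv
  have hFb : ∀ x, ‖F x‖ ≤ C := by
    intro x
    rw [hF]
    by_cases hx : x ∈ KK k
    · rw [indicator_of_mem hx]; exact hC x hx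
    · rw [indicator_of_notMem hx]; simp
  have e : ∀ r, IsRad r → ∀ x, ⟪bfield T r x, gradient v x⟫ = ⟪bfield T r x, F x⟫ := by
    intro r hr x
    by_cases hx : x ∈ KK k
    · rw [hF, indicator_of_mem hx]
    · rw [bfield_support hT hr hx]; simp
  have hIntg : ∀ r, IsRad r → Integrable (bfield (k := k) T r) →
      Integrable (fun x => ⟪bfield T r x, F x⟫) := by
    intro r hr hb
    refine Integrable.mono' (hb.norm.mul_const (C : ℝ)) ?_ ?_
    · exact ((bfield_meas hT.mono hr.lip.continuous).inner hFm).aestronglyMeasurable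
    · refine ae_of_all _ fun x => (norm_inner_le_norm _ _).trans ?_
      gcongr; exact hFb x
  have h1 : ∀ x, ⟪bfield T r x - bfield T s x, gradient v x⟫ =
      ⟪bfield T r x, F x⟫ - ⟪bfield T s x, F x⟫ := by
    intro x; rw [inner_sub_left, e r hr, e s hs]
  rw [setIntegral_eq_integral_of_forall_compl_eq_zero]
  · simp_rw [h1]
    rw [integral_sub (hIntg r hr hbr) (hIntg s hs hbs), field_formula hT hr hbr hFm hFb,
      field_formula hT hs hbs hFm hFb, sub_eq_zero]
    apply integral_congr_ae
    filter_upwards [nuu_ae] with p hp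
    rw [hF, flow hT hr hv hp, flow hT hs hv hp]
  · intro x hx
    have : x ∉ KK k := fun h => hx (KK_sub h)
    rw [bfield_support hT hr this, bfield_support hT hs this]
    simp

end

section

/-! ## The weight and integrability of the field -/

variable {k : ℕ}

def awt (T1 T2 : ℝ → ℝ) (β : ℝ) (x : E (k + 1)) : ℝ := (max 0 (rho T2 (x 0) - rho1 T1 x)) ^ β

lemma awt_nonneg (T1 T2 : ℝ → ℝ) (β : ℝ) (x : E (k + 1)) : 0 ≤ awt T1 T2 β x := by
  unfold awt; positivity

lemma awt_cont (T1 T2 : ℝ → ℝ) {β : ℝ} (hβ : 0 < β) : Continuous (awt (k := k) T1 T2 β) := by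
  unfold awt
  apply Continuous.rpow_const
  · apply continuous_const.max
    exact ((rho_cont T2).comp (by fun_prop)).sub (rho1_cont T1)
  · intro x; right; exact hβ.le

lemma rpow_sub_rpow_le {s t β : ℝ} (ht : 0 ≤ t) (hst : t ≤ s) (hβ : 0 < β) (hβ1 : β ≤ 1) :
    s ^ β - t ^ β ≤ (s - t) ^ β := by
  have := Real.rpow_add_le_add_rpow (a := s - t) (b := t) (by linarith) ht hβ.le hβ1
  rw [sub_add_cancel] at this
  linarith

lemma abs_rpow_sub_le {s t β : ℝ} (hs : 0 ≤ s) (ht : 0 ≤ t) (hβ : 0 < β) (hβ1 : β ≤ 1) :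
    |s ^ β - t ^ β| ≤ |s - t| ^ β := by
  rcases le_total t s with h | h
  · rw [abs_of_nonneg (sub_nonneg.2 (Real.rpow_le_rpow ht h hβ.le)), abs_of_nonneg (sub_nonneg.2 h)]
    exact rpow_sub_rpow_le ht h hβ hβ1
  · rw [abs_sub_comm, abs_sub_comm s t, abs_of_nonneg (sub_nonneg.2 (Real.rpow_le_rpow hs h hβ.le)),
      abs_of_nonneg (sub_nonneg.2 h)]
    exact rpow_sub_rpow_le hs h hβ hβ1

lemma awt_holder (T1 T2 : ℝ → ℝ) {β : ℝ} (hβ : 0 < β) (hβ1 : β ≤ 1) (S : Set (E (k + 1))) :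
    HolderOnWith 2 (Real.toNNReal β) (awt (k := k) T1 T2 β) S := by
  intro x _ y _
  have h1 : |awt T1 T2 β x - awt T1 T2 β y| ≤ 2 * ‖x - y‖ ^ β := by
    unfold awt
    refine (abs_rpow_sub_le (le_max_left _ _) (le_max_left _ _) hβ hβ1).trans ?_
    have h2 : |max 0 (rho T2 (x 0) - rho1 T1 x) - max 0 (rho T2 (y 0) - rho1 T1 y)| ≤ 2 * ‖x - y‖ := by
      refine (abs_max_sub_max_le_max 0 _ 0 _).trans ?_
      rw [sub_self, abs_zero, max_eq_right (abs_nonneg _)]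
      have a := abs_le.1 (rho2_sub_le T2 x y)
      have b := abs_le.1 (rho1_sub_le T1 x y)
      rw [abs_le]
      constructor <;> linarith [a.1, a.2, b.1, b.2]
    calc _ ≤ (2 * ‖x - y‖) ^ β := Real.rpow_le_rpow (abs_nonneg _) h2 hβ.le
      _ = 2 ^ β * ‖x - y‖ ^ β := Real.mul_rpow (by norm_num) (norm_nonneg _)
      _ ≤ 2 ^ (1:ℝ) * ‖x - y‖ ^ β := by
        gcongr; norm_num
      _ = _ := by norm_num
  have h3 : nndist (awt T1 T2 β x) (awt T1 T2 β y) ≤ 2 * nndist x y ^ β := by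
    rw [← NNReal.coe_le_coe]
    push_cast
    rw [Real.dist_eq, dist_eq_norm]; exact h1
  rw [edist_nndist, edist_nndist, Real.coe_toNNReal _ hβ.le,
    ← ENNReal.coe_rpow_of_nonneg _ hβ.le]
  exact_mod_cast h3

lemma rho2_rpow_le_Psi (hk : 0 < k) {T1 T2 : ℝ → ℝ} {τ s1 : ℝ} (hs1 : 0 < s1) {x : E (k + 1)}
    (hx : 0 < rho T2 (x 0) ∧ ∀ i : Fin k, 0 < rho T1 (x i.succ)) (h : rho1 T1 x ≤ rho T2 (x 0)) :
    rho T2 (x 0) ^ (-τ) ≤ Psi k T1 T2 (τ - s1) (s1 / k) x := by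
  have hp := rho1_pos hk hx.2
  calc rho T2 (x 0) ^ (-τ) = rho T2 (x 0) ^ (-(τ - s1)) * rho T2 (x 0) ^ (-s1) := by
        rw [← Real.rpow_add hx.1]; congr 1; ring
    _ ≤ rho T2 (x 0) ^ (-(τ - s1)) * rho1 T1 x ^ (-s1) := by
        apply mul_le_mul_of_nonneg_left _ (Real.rpow_nonneg hx.1.le _)
        exact Real.rpow_le_rpow_of_nonpos hp h (by linarith)
    _ ≤ _ := by
        apply mul_le_mul_of_nonneg_left _ (Real.rpow_nonneg hx.1.le _)
        exact rho1_rpow_le hk hs1 hx.2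

/-- admissible parameters -/
structure Par (k : ℕ) (p q β n1 n2 : ℝ) : Prop where
  hk : 0 < k
  hp : 1 < p
  hpq : p < q
  hβ : 0 < β
  hβ1 : β ≤ 1
  n1pos : 0 < n1
  n2pos : 0 < n2
  hlow : n2 * (p - 1) < k * n1
  hup : k * n1 + β < n2 * (q - 1)

def bb (T1 T2 : ℝ → ℝ) (x : E (k + 1)) : E (k + 1) :=
  bfield T1 (rho T2) x - bfield T1 (fun _ => 1 / 4) x

lemma bb_meas {T1 T2 : ℝ → ℝ} (hT : Monotone T1) : Measurable (bb (k := k) T1 T2) :=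
  (bfield_meas hT (rho_cont T2)).sub (bfield_meas hT continuous_const)

lemma mem_II_of_ne {T r : ℝ → ℝ} {x : E (k + 1)} (h : bfield T r x ≠ 0) : x 0 ∈ II := by
  by_contra hc
  exact h (by simp [bfield, hc])

lemma rho1_le_of_ne {T r : ℝ → ℝ} {x : E (k + 1)} (h : bfield T r x ≠ 0) : rho1 T x ≤ r (x 0) / 2 := by
  by_contra hc
  exact h (bfield_eq_zero (not_le.1 hc))

lemma bconst_bound {T : ℝ → ℝ} {n : ℝ} (hT : IsCantor n T) :
    ∃ B : ℝ, 0 < B ∧ ∀ x : E (k + 1), ‖bfield T (fun _ => 1 / 4) x‖ ≤ B := by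
  obtain ⟨C, hC, h⟩ := bfield_bound (k := k) hT
  exact ⟨C * (1 / 4) ^ (-(k * n)), by positivity, fun x => h _ isRad_const x (by norm_num)⟩

lemma bconst_integrable {T : ℝ → ℝ} {n : ℝ} (hT : IsCantor n T) :
    Integrable (bfield (k := k) T (fun _ => 1 / 4)) := by
  obtain ⟨B, hB, h⟩ := bconst_bound (k := k) hT
  have h1 : IntegrableOn (fun _ : E (k + 1) => B) (cube (k + 1)) :=
    integrableOn_const (cube_finite _).ne (by simp)
  refine Integrable.mono' ((integrable_indicator_iff (cube_meas _)).2 h1)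
    (bfield_meas hT.mono continuous_const).aestronglyMeasurable (ae_of_all _ fun x => ?_)
  by_cases hx : x ∈ cube (k + 1)
  · rw [indicator_of_mem hx]; exact h x
  · rw [bfield_support hT isRad_const (fun h => hx (KK_sub h)), indicator_of_notMem hx]; simp

lemma Par.exists_s1 {p q β n1 n2 : ℝ} (P : Par k p q β n1 n2) :
    ∃ τ s1 : ℝ, τ = (k * n1 * q + β) / (q - 1) ∧ k * n1 ≤ τ ∧ 0 < s1 ∧ s1 < k * n1 ∧ 0 < τ - s1 ∧ τ - s1 < n2 := by
  have hq1 : 0 < q - 1 := by linarith [P.hp, P.hpq]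
  have hk : (0:ℝ) < k := by exact_mod_cast P.hk
  have hm : 0 < k * n1 := mul_pos hk P.n1pos
  have e : (k * n1 * q + β) / (q - 1) = k * n1 + (k * n1 + β) / (q - 1) := by
    field_simp; ring
  have h1 : (k * n1 + β) / (q - 1) < n2 := by rw [div_lt_iff₀ hq1]; exact P.hup
  have h2 : 0 < (k * n1 + β) / (q - 1) := div_pos (by linarith [P.hβ]) hq1
  obtain ⟨s1, ha, hb⟩ := exists_between (show max 0 ((k * n1 * q + β) / (q - 1) - n2) < k * n1 from
    max_lt hm (by linarith))
  exact ⟨_, s1, rfl, by linarith, lt_of_le_of_lt (le_max_left _ _) ha, hb, by linarith,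
    by linarith [le_max_right 0 ((k * n1 * q + β) / (q - 1) - n2)]⟩

lemma brho_integrable {T1 T2 : ℝ → ℝ} {p q β n1 n2 : ℝ} (P : Par k p q β n1 n2)
    (h1 : IsCantor n1 T1) (h2 : IsCantor n2 T2) :
    Integrable (bfield (k := k) T1 (rho T2)) := by
  obtain ⟨τ, s1, hτ, hmτ, a, b, c, d⟩ := P.exists_s1
  have hk : (0:ℝ) < k := by exact_mod_cast P.hk
  obtain ⟨C, hC, hB⟩ := bfield_bound (k := k) h1
  have hPsi := Psi_integrable (k := k) (s := τ - s1) (σ := s1 / k) h1 h2 c d (by positivity)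
    (by rw [div_lt_iff₀ hk]; linarith)
  refine Integrable.mono' ((integrable_indicator_iff (cube_meas _)).2 (hPsi.const_mul C))
    (bfield_meas h1.mono (rho_cont T2)).aestronglyMeasurable ?_
  filter_upwards [ae_rho_pos h1 h2] with x hx
  by_cases hb : bfield T1 (rho T2) x = 0
  · rw [hb, norm_zero]
    exact indicator_nonneg (fun _ _ => mul_nonneg hC.le (Psi_nonneg _ _ _ _ _ _)) _
  · have hc : x ∈ cube (k + 1) := by
      by_contra hc
      exact hb (bfield_support h1 (isRad_rho h2) (fun h => hc (KK_sub h)))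
    rw [indicator_of_mem hc]
    refine (hB _ (isRad_rho h2) x hx.1).trans ?_
    apply mul_le_mul_of_nonneg_left _ hC.le
    refine le_trans ?_ (rho2_rpow_le_Psi P.hk a hx (by linarith [rho1_le_of_ne hb]))
    apply Real.rpow_le_rpow_of_exponent_ge hx.1
    · linarith [(isRad_rho h2).le _ (mem_II_of_ne hb)]
    · linarith

lemma bb_integrable {T1 T2 : ℝ → ℝ} {p q β n1 n2 : ℝ} (P : Par k p q β n1 n2)
    (h1 : IsCantor n1 T1) (h2 : IsCantor n2 T2) : Integrable (bb (k := k) T1 T2) :=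
  (brho_integrable P h1 h2).sub (bconst_integrable h1)

lemma conj_integrable {T1 T2 : ℝ → ℝ} {p q β n1 n2 : ℝ} (P : Par k p q β n1 n2)
    (h1 : IsCantor n1 T1) (h2 : IsCantor n2 T2) :
    IntegrableOn (fun x => conjFn (doublePhase p q (awt T1 T2 β x)) ‖bb T1 T2 x‖) (cube (k + 1)) := by
  obtain ⟨τ, s1, hτ, hmτ, a, b, c, d⟩ := P.exists_s1
  have hk : (0:ℝ) < k := by exact_mod_cast P.hk
  have hq1 : 0 < q - 1 := by linarith [P.hp, P.hpq]
  have hp1 : 0 < p - 1 := by linarith [P.hp]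
  have hp0 : 0 < p := by linarith
  have hq0 : 0 < q := by linarith
  obtain ⟨C, hC, hCb⟩ := bfield_bound (k := k) h1
  obtain ⟨B, hB, hBb⟩ := bconst_bound (k := k) h1
  have hPsi := Psi_integrable (k := k) (s := τ - s1) (σ := s1 / k) h1 h2 c d (by positivity)
    (by rw [div_lt_iff₀ hk]; linarith)
  set C' : ℝ := (C + B) ^ (q / (q - 1)) * (1 / 2) ^ (-(β / (q - 1))) with hC'
  have hC'0 : 0 < C' := by positivity
  have hc1 : IntegrableOn (fun _ : E (k + 1) => B ^ (p / (p - 1))) (cube (k + 1)) :=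
    integrableOn_const (cube_finite _).ne (by simp)
  refine Integrable.mono' (hc1.add (hPsi.const_mul C')) ?_ ?_
  · exact (conj_measurable P.hp hq0 (awt_cont T1 T2 P.hβ).measurable (bb_meas h1.mono).norm
      (awt_nonneg T1 T2 β)).aestronglyMeasurable
  filter_upwards [ae_restrict_of_ae (ae_rho_pos h1 h2)] with x hx
  rw [Real.norm_of_nonneg (conj_nonneg P.hp hq0 (awt_nonneg _ _ _ _))]
  simp only [Pi.add_apply]
  by_cases hb : bfield T1 (rho T2) x = 0
  · have e : ‖bb T1 T2 x‖ ≤ B := by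
      rw [bb, hb, zero_sub, norm_neg]; exact hBb x
    have := Real.rpow_le_rpow (norm_nonneg _) e (by positivity : 0 ≤ p / (p - 1))
    have h3 := conj_le_p (s := ‖bb T1 T2 x‖) P.hp hq0 (awt_nonneg T1 T2 β x) (norm_nonneg _)
    have h4 := mul_nonneg hC'0.le (Psi_nonneg k T1 T2 (τ - s1) (s1 / k) x)
    linarith
  · have h5 := rho1_le_of_ne hb
    have h6 := (isRad_rho h2).le _ (mem_II_of_ne hb)
    set ρ := rho T2 (x 0) with hρ
    have hρ0 : 0 < ρ := hx.1
    have e : ‖bb T1 T2 x‖ ≤ (C + B) * ρ ^ (-(k * n1)) := by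
      have h7 : 1 ≤ ρ ^ (-(k * n1)) :=
        Real.one_le_rpow_of_pos_of_le_one_of_nonpos hx.1 (by linarith)
          (by have := mul_pos hk P.n1pos; linarith)
      calc ‖bb T1 T2 x‖ ≤ ‖bfield T1 (rho T2) x‖ + ‖bfield T1 (fun _ => 1 / 4) x‖ := norm_sub_le _ _
        _ ≤ C * ρ ^ (-(k * n1)) + B * 1 := by
          rw [mul_one]; exact add_le_add (hCb _ (isRad_rho h2) x hx.1) (hBb x)
        _ ≤ C * ρ ^ (-(k * n1)) + B * ρ ^ (-(k * n1)) := by gcongr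
        _ = _ := by ring
    have ha : (ρ * (1 / 2)) ^ β ≤ awt T1 T2 β x := by
      unfold awt
      apply Real.rpow_le_rpow (by positivity) _ P.hβ.le
      exact le_trans (by linarith) (le_max_right _ _)
    have ha0 : 0 < (ρ * (1 / 2)) ^ β := by positivity
    have h8 := conj_le_q (s := ‖bb T1 T2 x‖) hp0 (by linarith : 1 < q) (ha0.trans_le ha) (norm_nonneg _)
    refine h8.trans ?_
    have h9 : ‖bb T1 T2 x‖ ^ (q / (q - 1)) * awt T1 T2 β x ^ (-(1 / (q - 1))) ≤ C' * ρ ^ (-τ) := by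
      calc _ ≤ ((C + B) * ρ ^ (-(k * n1))) ^ (q / (q - 1)) * ((ρ * (1 / 2)) ^ β) ^ (-(1 / (q - 1))) := by
            apply mul_le_mul
            · exact Real.rpow_le_rpow (norm_nonneg _) e (by positivity)
            · apply Real.rpow_le_rpow_of_nonpos ha0 ha
              have : 0 < 1 / (q - 1) := by positivity
              linarith
            · exact Real.rpow_nonneg (awt_nonneg _ _ _ _) _
            · positivity
        _ = C' * ρ ^ (-τ) := by
            rw [Real.mul_rpow (by positivity) (by positivity), ← Real.rpow_mul (by positivity),
              ← Real.rpow_mul (by positivity), Real.mul_rpow (by positivity) (by positivity), hC', hτ]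
            have e1 : β * -(1 / (q - 1)) = -(β / (q - 1)) := by ring
            have e2 : ρ ^ (-((k * n1 * q + β) / (q - 1))) =
              ρ ^ (-(k * n1) * (q / (q - 1))) * ρ ^ (-(β / (q - 1))) := by
              rw [← Real.rpow_add hρ0]; congr 1; ring
            rw [e1, e2]; ring
    refine h9.trans ?_
    have h10 := rho2_rpow_le_Psi (τ := τ) P.hk a hx (by linarith)
    have h11 : 0 ≤ B ^ (p / (p - 1)) := by positivity
    have h12 := mul_le_mul_of_nonneg_left h10 hC'0.le
    linarith

end

section

/-! ## The competitor -/

variable {k : ℕ}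

def clip (a : ℝ) : ℝ := max (-1) (min 1 a)

lemma clip_abs (a : ℝ) : |clip a| ≤ 1 := by
  unfold clip; rw [abs_le]
  exact ⟨le_max_left _ _, max_le (by norm_num) (min_le_left _ _)⟩

lemma clip_lip (a b : ℝ) : |clip a - clip b| ≤ |a - b| := by
  unfold clip
  refine (abs_max_sub_max_le_max _ _ _ _).trans ?_
  rw [sub_self, abs_zero, max_eq_right (abs_nonneg _)]
  refine (abs_min_sub_min_le_max _ _ _ _).trans ?_
  rw [sub_self, abs_zero, max_eq_right (abs_nonneg _)]

lemma clip_one {a : ℝ} (h : 1 ≤ a) : clip a = 1 := by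
  unfold clip; rw [min_eq_left h]; norm_num

lemma clip_neg_one {a : ℝ} (h : a ≤ -1) : clip a = -1 := by
  unfold clip; rw [min_eq_right (by linarith), max_eq_left h]

lemma clip_meas : Measurable clip := by unfold clip; fun_prop

lemma clip_far {A A' M M' : ℝ} (hM : 0 < M) (hM' : 0 < M') (h1 : M ≤ |A|) (h2 : |A - A'| + M' ≤ |A|) :
    clip (A / M) = clip (A' / M') := by
  rcases le_total 0 A with h | h
  · rw [abs_of_nonneg h] at h1 h2
    have := (abs_le.1 (le_refl |A - A'|)).2
    rw [clip_one ((one_le_div hM).2 h1), clip_one ((one_le_div hM').2 (by linarith))]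
  · rw [abs_of_nonpos h] at h1 h2
    have := (abs_le.1 (le_refl |A - A'|)).1
    rw [clip_neg_one, clip_neg_one]
    · rw [div_le_iff₀ hM']; linarith
    · rw [div_le_iff₀ hM]; linarith

def MM (T1 : ℝ → ℝ) (ε : ℝ) (x : E (k + 1)) : ℝ := max (rho1 T1 x) ε

def uu (T1 T2 : ℝ → ℝ) (ε : ℝ) (x : E (k + 1)) : ℝ :=
  1 / 2 * ∫ τ in Icc (0:ℝ) 1, clip ((x 0 - T2 τ) / MM T1 ε x)

lemma MM_sub_le (T1 : ℝ → ℝ) (ε : ℝ) (x y : E (k + 1)) : |MM T1 ε x - MM T1 ε y| ≤ ‖x - y‖ := by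
  unfold MM
  refine (abs_max_sub_max_le_max _ _ _ _).trans ?_
  rw [sub_self, abs_zero, max_eq_left (abs_nonneg _)]
  exact rho1_sub_le T1 x y

lemma uu_meas_int {T2 : ℝ → ℝ} (h2 : Monotone T2) (c M : ℝ) :
    IntegrableOn (fun τ => clip ((c - T2 τ) / M)) (Icc (0:ℝ) 1) := by
  refine Integrable.of_bound (C := 1) ?_ (ae_of_all _ fun τ => clip_abs _)
  have := h2.measurable
  exact (clip_meas.comp (by fun_prop)).aestronglyMeasurable

lemma uu_abs {T1 T2 : ℝ → ℝ} (ε : ℝ) (x : E (k + 1)) : |uu T1 T2 ε x| ≤ 1 / 2 := by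
  unfold uu
  rw [abs_mul]
  have := norm_setIntegral_le_of_norm_le_const (μ := volume) (s := Icc (0:ℝ) 1) (C := 1)
    (f := fun τ => clip ((x 0 - T2 τ) / MM T1 ε x)) (by simp) (fun τ _ => clip_abs _)
  rw [Real.norm_eq_abs] at this
  have e : volume.real (Icc (0:ℝ) 1) = 1 := by simp
  rw [e] at this
  rw [abs_of_pos (by norm_num : (0:ℝ) < 1 / 2)]
  linarith

lemma uu_local {T1 T2 : ℝ → ℝ} {n2 : ℝ} (h2 : IsCantor n2 T2) (hn : 0 < n2) (hn1 : n2 < 1) :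
    ∃ C : ℝ, 0 < C ∧ ∀ (ε : ℝ) (x x' : E (k + 1)), 0 < MM T1 ε x → ‖x' - x‖ ≤ MM T1 ε x / 4 →
      |uu T1 T2 ε x' - uu T1 T2 ε x| ≤ C * MM T1 ε x ^ (-n2) * ‖x' - x‖ := by
  obtain ⟨C, hC, hf⟩ := h2.frost
  refine ⟨4 * C, by positivity, fun ε x x' hM hd => ?_⟩
  set M := MM T1 ε x with hMd
  set M' := MM T1 ε x' with hMd'
  set δ := ‖x' - x‖ with hδ
  have hMM := abs_le.1 (MM_sub_le T1 ε x' x)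
  have hM' : 3 * M / 4 ≤ M' := by linarith [hMM.1]
  have hM'u : M' ≤ 5 * M / 4 := by linarith [hMM.2]
  have hM'0 : 0 < M' := by linarith
  have hδ0 : 0 ≤ δ := norm_nonneg _
  set S : Set ℝ := {τ ∈ Icc (0:ℝ) 1 | |x 0 - T2 τ| ≤ 2 * M} with hS
  have hSm : MeasurableSet S := by
    have := h2.mono.measurable
    exact measurableSet_Icc.inter (measurableSet_le (f := fun t => |x 0 - T2 t|) (by fun_prop) measurable_const)
  have hpt : ∀ τ ∈ Icc (0:ℝ) 1, ‖clip ((x' 0 - T2 τ) / M') - clip ((x 0 - T2 τ) / M)‖ ≤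
      S.indicator (fun _ => 4 * δ / M) τ := by
    intro τ hτ
    have hA : |(x 0 - T2 τ) - (x' 0 - T2 τ)| ≤ δ := by
      rw [sub_sub_sub_cancel_right, abs_sub_comm]; exact coord_sub_le x' x 0
    by_cases hc : |x 0 - T2 τ| ≤ 2 * M
    · rw [indicator_of_mem (show τ ∈ S from ⟨hτ, hc⟩), Real.norm_eq_abs]
      refine (clip_lip _ _).trans ?_
      generalize hAe : x 0 - T2 τ = A at *
      generalize hAe' : x' 0 - T2 τ = A' at *
      have e : A' / M' - A / M = ((A' - A) * M + A * (M - M')) / (M * M') := by field_simp; ring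
      rw [e, abs_div, abs_of_pos (mul_pos hM hM'0), div_le_div_iff₀ (mul_pos hM hM'0) hM]
      have h3 : |(A' - A) * M + A * (M - M')| ≤ 3 * δ * M := by
        refine (abs_add_le _ _).trans ?_
        rw [abs_mul, abs_mul, abs_of_pos hM, abs_sub_comm A' A]
        have : |M - M'| ≤ δ := by rw [abs_sub_comm]; exact abs_le.2 hMM
        nlinarith [abs_nonneg A, abs_nonneg (M - M'), mul_le_mul hc this (abs_nonneg _) (by positivity)]
      nlinarith [mul_le_mul_of_nonneg_right h3 hM.le, mul_nonneg hδ0 hM.le, mul_le_mul_of_nonneg_left hM' (mul_nonneg hδ0 hM.le)]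
    · rw [indicator_of_notMem (fun h => hc h.2)]
      rw [not_le] at hc
      rw [clip_far (A := x 0 - T2 τ) (A' := x' 0 - T2 τ) hM hM'0 (by linarith) (by linarith)]
      simp
  have hIntg : IntegrableOn (S.indicator (fun _ => 4 * δ / M)) (Icc (0:ℝ) 1) := by
    apply Integrable.indicator _ hSm
    exact integrable_const _
  have h4 : ‖∫ τ in Icc (0:ℝ) 1, (clip ((x' 0 - T2 τ) / M') - clip ((x 0 - T2 τ) / M))‖ ≤
      ∫ τ in Icc (0:ℝ) 1, S.indicator (fun _ => 4 * δ / M) τ := by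
    apply norm_integral_le_of_norm_le hIntg
    filter_upwards [ae_restrict_mem measurableSet_Icc] with τ hτ using hpt τ hτ
  have h5 : ∫ τ in Icc (0:ℝ) 1, S.indicator (fun _ => 4 * δ / M) τ = volume.real S * (4 * δ / M) := by
    rw [setIntegral_indicator hSm, setIntegral_const, smul_eq_mul]
    congr 2
    exact inter_eq_right.2 fun τ h => h.1
  have h6 := hf (x 0) (2 * M) (by positivity)
  rw [integral_sub (uu_meas_int h2.mono _ _) (uu_meas_int h2.mono _ _), Real.norm_eq_abs, h5] at h4
  unfold uu
  rw [← mul_sub, abs_mul, abs_of_pos (by norm_num : (0:ℝ) < 1 / 2)]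
  have h7 : (2 * M) ^ (1 - n2) ≤ 2 * (M ^ (-n2) * M) := by
    rw [Real.mul_rpow (by norm_num) hM.le]
    have e1 : M ^ (1 - n2) = M ^ (-n2) * M := by
      rw [sub_eq_neg_add, Real.rpow_add hM, Real.rpow_one]
    rw [e1]
    have : (2:ℝ) ^ (1 - n2) ≤ 2 ^ (1:ℝ) := Real.rpow_le_rpow_of_exponent_le (by norm_num) (by linarith)
    rw [Real.rpow_one] at this
    gcongr
  have h8 : volume.real S * (4 * δ / M) ≤ C * (2 * (M ^ (-n2) * M)) * (4 * δ / M) := by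
    apply mul_le_mul_of_nonneg_right _ (by positivity)
    exact h6.trans (by gcongr)
  have h9 : C * (2 * (M ^ (-n2) * M)) * (4 * δ / M) = 2 * (4 * C * M ^ (-n2) * δ) := by
    field_simp
  linarith

lemma uu_const {T1 T2 : ℝ → ℝ} {ε : ℝ} {x : E (k + 1)} (hM : 0 < MM T1 ε x)
    (h : MM T1 ε x < rho T2 (x 0)) : ∀ᶠ x' in 𝓝 x, uu T1 T2 ε x' = uu T1 T2 ε x := by
  have h0 : 0 < min (MM T1 ε x) ((rho T2 (x 0) - MM T1 ε x) / 2) := lt_min hM (by linarith)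
  filter_upwards [ball_mem_nhds x h0] with x' hx'
  rw [mem_ball, dist_eq_norm] at hx'
  have a := hx'.trans_le (min_le_left _ _)
  have b := hx'.trans_le (min_le_right _ _)
  have hMM := abs_le.1 (MM_sub_le T1 ε x' x)
  unfold uu
  congr 1
  apply setIntegral_congr_fun measurableSet_Icc
  intro τ hτ
  have h3 := rho_le T2 (x 0) hτ
  have hA : |(x 0 - T2 τ) - (x' 0 - T2 τ)| ≤ ‖x' - x‖ := by
    rw [sub_sub_sub_cancel_right, abs_sub_comm]; exact coord_sub_le x' x 0
  exact (clip_far hM (by linarith [hMM.1]) (by linarith) (by linarith [hMM.2])).symm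

lemma uu_lip {T1 T2 : ℝ → ℝ} {n2 : ℝ} (h2 : IsCantor n2 T2) (hn : 0 < n2) (hn1 : n2 < 1) {ε : ℝ}
    (hε : 0 < ε) : ∃ L : ℝ, 0 < L ∧ ∀ x x' : E (k + 1),
      |uu T1 T2 ε x' - uu T1 T2 ε x| ≤ L * ‖x' - x‖ := by
  obtain ⟨C, hC, h⟩ := uu_local (k := k) (T1 := T1) h2 hn hn1
  refine ⟨C * ε ^ (-n2) + 4 / ε, by positivity, fun x x' => ?_⟩
  have hM : ε ≤ MM T1 ε x := le_max_right _ _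
  rcases le_total ‖x' - x‖ (ε / 4) with hd | hd
  · refine (h ε x x' (by linarith) (by linarith)).trans ?_
    apply mul_le_mul_of_nonneg_right _ (norm_nonneg _)
    have : MM T1 ε x ^ (-n2) ≤ ε ^ (-n2) := Real.rpow_le_rpow_of_nonpos hε hM (by linarith)
    have h4 : 0 < 4 / ε := by positivity
    nlinarith
  · have a := abs_sub (uu T1 T2 ε x') (uu T1 T2 ε x)
    have b := uu_abs (T1 := T1) (T2 := T2) ε x
    have c := uu_abs (T1 := T1) (T2 := T2) ε x'
    have e : 1 ≤ 4 / ε * ‖x' - x‖ := by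
      rw [div_mul_eq_mul_div, le_div_iff₀ hε]; linarith
    have : 0 ≤ C * ε ^ (-n2) * ‖x' - x‖ := by positivity
    have a' : |uu T1 T2 ε x' - uu T1 T2 ε x| ≤ 1 := by
      have := abs_le.1 b; have := abs_le.1 c
      rw [abs_le]; constructor <;> linarith [(abs_le.1 b).1, (abs_le.1 b).2, (abs_le.1 c).1, (abs_le.1 c).2]
    nlinarith

/-! ## Cutoff -/

def sn (x : E (k + 1)) : ℝ := ‖(WithLp.ofLp x : Fin (k + 1) → ℝ)‖

def cut (x : E (k + 1)) : ℝ := max 0 (min 1 (4 - 5 * sn x))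

lemma sn_sub_le (x y : E (k + 1)) : |sn x - sn y| ≤ ‖x - y‖ := by
  unfold sn
  refine (abs_norm_sub_norm_le _ _).trans ?_
  rw [pi_norm_le_iff_of_nonneg (norm_nonneg _)]
  intro i
  exact coord_sub_le x y i

lemma sn_cont : Continuous (sn (k := k)) := by unfold sn; fun_prop

lemma cut_sub_le (x y : E (k + 1)) : |cut x - cut y| ≤ 5 * ‖x - y‖ := by
  unfold cut
  refine (abs_max_sub_max_le_max _ _ _ _).trans ?_
  rw [sub_self, abs_zero, max_eq_right (abs_nonneg _)]
  refine (abs_min_sub_min_le_max _ _ _ _).trans ?_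
  rw [sub_self, abs_zero, max_eq_right (abs_nonneg _)]
  have h := abs_le.1 (sn_sub_le x y)
  rw [abs_le]; constructor <;> linarith [h.1, h.2]

lemma cut_nonneg (x : E (k + 1)) : 0 ≤ cut x := le_max_left _ _
lemma cut_le (x : E (k + 1)) : cut x ≤ 1 := max_le zero_le_one (min_le_left _ _)

lemma cut_one {x : E (k + 1)} (h : sn x ≤ 3 / 5) : cut x = 1 := by
  unfold cut; rw [min_eq_left (by linarith)]; norm_num

lemma cut_zero {x : E (k + 1)} (h : 4 / 5 ≤ sn x) : cut x = 0 := by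
  unfold cut; rw [max_eq_left]; exact (min_le_right _ _).trans (by linarith)

lemma sn_KK {x : E (k + 1)} (h : x ∈ KK k) : sn x ≤ 1 / 2 := by
  unfold sn
  rw [pi_norm_le_iff_of_nonneg (by norm_num)]
  intro i
  rw [Real.norm_eq_abs, abs_le]
  exact ⟨by linarith [(h i).1], (h i).2⟩

lemma sn_cube {x : E (k + 1)} (h : x ∉ cube (k + 1)) : 1 ≤ sn x := by
  by_contra hc
  apply h
  intro i
  have := (norm_le_pi_norm (WithLp.ofLp x : Fin (k + 1) → ℝ) i).trans_lt (not_le.1 hc)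
  rw [Real.norm_eq_abs, abs_lt] at this
  exact this

end

section

/-! ## The truncated competitor and its gradient -/

variable {k : ℕ}

def ww (T1 T2 : ℝ → ℝ) (ε : ℝ) (x : E (k + 1)) : ℝ := cut x * uu T1 T2 ε x

def DD (T1 T2 : ℝ → ℝ) (ε : ℝ) (i : Fin (k + 1)) (x : E (k + 1)) : ℝ :=
  lineDeriv ℝ (ww T1 T2 ε) x (EuclideanSpace.single i 1)

lemma ww_sub_le (T1 T2 : ℝ → ℝ) (ε : ℝ) (x x' : E (k + 1)) :
    |ww T1 T2 ε x' - ww T1 T2 ε x| ≤ 5 / 2 * ‖x' - x‖ + |uu T1 T2 ε x' - uu T1 T2 ε x| := by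
  unfold ww
  have e : cut x' * uu T1 T2 ε x' - cut x * uu T1 T2 ε x =
    (cut x' - cut x) * uu T1 T2 ε x' + cut x * (uu T1 T2 ε x' - uu T1 T2 ε x) := by ring
  rw [e]
  refine (abs_add_le _ _).trans ?_
  rw [abs_mul, abs_mul, abs_of_nonneg (cut_nonneg x)]
  have a := cut_sub_le x' x
  have b := uu_abs (T1 := T1) (T2 := T2) ε x'
  have c := cut_le x
  have h1 := mul_le_mul a b (abs_nonneg _) (by positivity)
  have h2 := mul_le_mul_of_nonneg_right c (abs_nonneg (uu T1 T2 ε x' - uu T1 T2 ε x))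
  linarith

lemma ww_lip {T1 T2 : ℝ → ℝ} {n2 : ℝ} (h2 : IsCantor n2 T2) (hn : 0 < n2) (hn1 : n2 < 1) {ε : ℝ}
    (hε : 0 < ε) : ∃ L : ℝ≥0, LipschitzWith L (ww (k := k) T1 T2 ε) := by
  obtain ⟨L, hL, h⟩ := uu_lip (k := k) (T1 := T1) h2 hn hn1 hε
  refine ⟨Real.toNNReal (5 / 2 + L), lipschitz_of_abs fun x y => ?_⟩
  refine (ww_sub_le T1 T2 ε y x).trans ?_
  have := h y x
  rw [Real.coe_toNNReal _ (by positivity)]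
  linarith

lemma single_norm (i : Fin (k + 1)) : ‖(EuclideanSpace.single i 1 : E (k + 1))‖ = 1 := by simp

lemma DD_bound_a {T1 T2 : ℝ → ℝ} {n2 : ℝ} (h2 : IsCantor n2 T2) (hn : 0 < n2) (hn1 : n2 < 1) :
    ∃ C : ℝ, 0 < C ∧ ∀ (ε : ℝ) (i : Fin (k + 1)) (x : E (k + 1)), 0 < MM T1 ε x →
      |DD T1 T2 ε i x| ≤ 5 / 2 + C * MM T1 ε x ^ (-n2) := by
  obtain ⟨C, hC, h⟩ := uu_local (k := k) (T1 := T1) h2 hn hn1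
  refine ⟨C, hC, fun ε i x hM => ?_⟩
  have h0 : 0 ≤ 5 / 2 + C * MM T1 ε x ^ (-n2) := by positivity
  have := norm_lineDeriv_le_of_lip' ℝ (f := ww T1 T2 ε) (x₀ := x) (v := EuclideanSpace.single i 1) h0 (by
    filter_upwards [closedBall_mem_nhds x (show 0 < MM T1 ε x / 4 by linarith)] with x' hx'
    rw [mem_closedBall, dist_eq_norm] at hx'
    rw [Real.norm_eq_abs]
    refine (ww_sub_le T1 T2 ε x x').trans ?_
    have := h ε x x' hM hx'
    linarith)
  rw [single_norm, mul_one] at this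
  exact this

lemma DD_bound_b {T1 T2 : ℝ → ℝ} {ε : ℝ} (i : Fin (k + 1)) {x : E (k + 1)} (hM : 0 < MM T1 ε x)
    (h : MM T1 ε x < rho T2 (x 0)) : |DD T1 T2 ε i x| ≤ 5 / 2 := by
  have := norm_lineDeriv_le_of_lip' ℝ (f := ww T1 T2 ε) (x₀ := x) (v := EuclideanSpace.single i 1)
    (show (0:ℝ) ≤ 5 / 2 by norm_num) (by
    filter_upwards [uu_const hM h] with x' hx'
    rw [Real.norm_eq_abs]
    refine (ww_sub_le T1 T2 ε x x').trans ?_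
    rw [hx']; simp)
  rw [single_norm, mul_one] at this
  exact this

lemma DD_zero_out {T1 T2 : ℝ → ℝ} {ε : ℝ} (i : Fin (k + 1)) {x : E (k + 1)} (h : 4 / 5 < sn x) :
    DD T1 T2 ε i x = 0 := by
  have : ww T1 T2 ε =ᶠ[𝓝 x] fun _ => 0 := by
    filter_upwards [(isOpen_lt continuous_const sn_cont).mem_nhds h] with y hy
    unfold ww
    rw [cut_zero (le_of_lt hy), zero_mul]
  unfold DD
  rw [this.lineDeriv_eq]
  simp [lineDeriv]

lemma DD_zero_in {T1 T2 : ℝ → ℝ} {ε : ℝ} (i : Fin (k + 1)) {x : E (k + 1)} (h : sn x < 3 / 5)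
    (hM : 0 < MM T1 ε x) (h' : MM T1 ε x < rho T2 (x 0)) :
    DD T1 T2 ε i x = 0 := by
  have : ww T1 T2 ε =ᶠ[𝓝 x] fun _ => uu T1 T2 ε x := by
    filter_upwards [(isOpen_lt sn_cont continuous_const).mem_nhds h, uu_const hM h'] with y hy hy'
    unfold ww
    rw [cut_one (le_of_lt hy), one_mul, hy']
  unfold DD
  rw [this.lineDeriv_eq]
  simp [lineDeriv]

lemma ww_zero_eventually {T1 T2 : ℝ → ℝ} {x : E (k + 1)} {ε : ℝ} (hε : 0 ≤ ε)
    (h : ε < rho1 T1 x) : ww T1 T2 ε =ᶠ[𝓝 x] ww T1 T2 0 := by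
  filter_upwards [(isOpen_lt continuous_const (rho1_cont T1)).mem_nhds h] with y hy
  unfold ww uu MM
  rw [max_eq_left (le_of_lt hy), max_eq_left (rho1_nonneg _ _)]

lemma DD_eq_zero_eps {T1 T2 : ℝ → ℝ} {x : E (k + 1)} {ε : ℝ} (hε : 0 ≤ ε)
    (h : ε < rho1 T1 x) (i : Fin (k + 1)) : DD T1 T2 ε i x = DD T1 T2 0 i x :=
  (ww_zero_eventually hε h).lineDeriv_eq

lemma rpow_sum_le {a b p : ℝ} (ha : 0 ≤ a) (hb : 0 ≤ b) (hp : 0 < p) :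
    (a + b) ^ p ≤ 2 ^ p * (a ^ p + b ^ p) := by
  rcases le_total a b with h | h
  · calc (a + b) ^ p ≤ (2 * b) ^ p := Real.rpow_le_rpow (by positivity) (by linarith) hp.le
      _ = 2 ^ p * b ^ p := Real.mul_rpow (by norm_num) hb
      _ ≤ _ := by
        have := Real.rpow_nonneg ha p
        gcongr; linarith
  · calc (a + b) ^ p ≤ (2 * a) ^ p := Real.rpow_le_rpow (by positivity) (by linarith) hp.le
      _ = 2 ^ p * a ^ p := Real.mul_rpow (by norm_num) ha
      _ ≤ _ := by
        have := Real.rpow_nonneg hb p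
        gcongr; linarith

/-- Uniform domination of the `p`-th power of the partial derivatives. -/
lemma DD_dom {T1 T2 : ℝ → ℝ} {p q β n1 n2 : ℝ} (P : Par k p q β n1 n2) (h1 : IsCantor n1 T1)
    (h2 : IsCantor n2 T2) (hn1 : n2 < 1) :
    ∃ H : E (k + 1) → ℝ, IntegrableOn H (cube (k + 1)) ∧ (∀ x, 0 ≤ H x) ∧
      ∀ x : E (k + 1), (0 < rho T2 (x 0) ∧ ∀ i : Fin k, 0 < rho T1 (x i.succ)) →
        ∀ ε : ℝ, 0 ≤ ε → ∀ i, |DD T1 T2 ε i x| ^ p ≤ H x := by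
  obtain ⟨C, hC, h⟩ := DD_bound_a (k := k) (T1 := T1) h2 P.n2pos hn1
  have hp := P.hp
  have hn := P.n2pos
  have hkp : (0:ℝ) < k := by exact_mod_cast P.hk
  obtain ⟨s, hs1, hs2⟩ : ∃ s, max 0 (n2 * p - k * n1) < s ∧ s < n2 :=
    exists_between (max_lt hn (by linarith [P.hlow]))
  have hs0 : 0 < s := (le_max_left _ _).trans_lt hs1
  have hs3 : n2 * p - k * n1 < s := (le_max_right _ _).trans_lt hs1
  have hs4 : 0 < n2 * p - s := by nlinarith
  refine ⟨fun x => 2 ^ p * ((5 / 2) ^ p + C ^ p * Psi k T1 T2 s ((n2 * p - s) / k) x), ?_, ?_, ?_⟩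
  · apply Integrable.const_mul
    have : IsFiniteMeasure (volume.restrict (cube (k + 1))) := ⟨by simpa using cube_finite (k + 1)⟩
    apply (integrable_const _).add
    apply Integrable.const_mul
    refine Psi_integrable h1 h2 hs0 hs2 (by positivity) ?_
    rw [div_lt_iff₀ hkp]; linarith
  · intro x
    have := Psi_nonneg k T1 T2 s ((n2 * p - s) / k) x
    positivity
  · intro x hx ε hε i
    have hPsi := Psi_nonneg k T1 T2 s ((n2 * p - s) / k) x
    have hr1 : 0 < rho1 T1 x := rho1_pos P.hk hx.2
    have hM1 : rho1 T1 x ≤ MM T1 ε x := le_max_left _ _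
    have hM : 0 < MM T1 ε x := by linarith
    by_cases hc : MM T1 ε x < rho T2 (x 0)
    · have := DD_bound_b i hM hc
      calc |DD T1 T2 ε i x| ^ p ≤ (5 / 2) ^ p := Real.rpow_le_rpow (abs_nonneg _) this (by linarith)
        _ ≤ (5 / 2) ^ p + C ^ p * Psi k T1 T2 s ((n2 * p - s) / k) x := by
          have : 0 ≤ C ^ p * Psi k T1 T2 s ((n2 * p - s) / k) x := by positivity
          linarith
        _ ≤ _ := by
          apply le_mul_of_one_le_left (by positivity)
          exact Real.one_le_rpow (by norm_num) (by linarith)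
    · rw [not_lt] at hc
      calc |DD T1 T2 ε i x| ^ p ≤ (5 / 2 + C * MM T1 ε x ^ (-n2)) ^ p :=
            Real.rpow_le_rpow (abs_nonneg _) (h ε i x hM) (by linarith)
        _ ≤ 2 ^ p * ((5 / 2) ^ p + (C * MM T1 ε x ^ (-n2)) ^ p) :=
            rpow_sum_le (by norm_num) (by positivity) (by linarith)
        _ ≤ _ := by
          beta_reduce
          gcongr
          rw [Real.mul_rpow hC.le (by positivity)]
          gcongr
          rw [← Real.rpow_mul hM.le, show -n2 * p = -s + -(n2 * p - s) by ring, Real.rpow_add hM]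
          unfold Psi
          refine mul_le_mul ?_ ?_ (Real.rpow_nonneg hM.le _) (Real.rpow_nonneg hx.1.le _)
          · exact Real.rpow_le_rpow_of_nonpos hx.1 hc (by linarith)
          · refine le_trans ?_ (rho1_rpow_le P.hk hs4 hx.2)
            exact Real.rpow_le_rpow_of_nonpos hr1 hM1 (by linarith)

end

section

/-! ## The competitor is in `W_0^{1,1}` and has finite energy -/

variable {k : ℕ}

def epsn (n : ℕ) : ℝ := 1 / ((n:ℝ) + 1)

lemma epsn_pos (n : ℕ) : 0 < epsn n := by unfold epsn; positivity

lemma epsn_lt {c : ℝ} (hc : 0 < c) : ∀ᶠ n in atTop, epsn n < c :=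
  (tendsto_one_div_add_atTop_nhds_zero_nat (𝕜 := ℝ)).eventually_lt_const hc

lemma ww_tendsto {T1 T2 : ℝ → ℝ} {x : E (k + 1)} (h : 0 < rho1 T1 x) :
    Tendsto (fun n => ww T1 T2 (epsn n) x) atTop (𝓝 (ww T1 T2 0 x)) := by
  apply tendsto_const_nhds.congr'
  filter_upwards [epsn_lt h] with n hn
  exact ((ww_zero_eventually (epsn_pos n).le hn).eq_of_nhds).symm

lemma DD_tendsto {T1 T2 : ℝ → ℝ} {x : E (k + 1)} (h : 0 < rho1 T1 x) (i : Fin (k + 1)) :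
    Tendsto (fun n => DD T1 T2 (epsn n) i x) atTop (𝓝 (DD T1 T2 0 i x)) := by
  apply tendsto_const_nhds.congr'
  filter_upwards [epsn_lt h] with n hn
  exact (DD_eq_zero_eps (epsn_pos n).le hn i).symm

section
variable {T1 T2 : ℝ → ℝ} {p q β n1 n2 : ℝ}

lemma ww_cont (h2 : IsCantor n2 T2) (hn : 0 < n2) (hn1 : n2 < 1) {ε : ℝ} (hε : 0 < ε) :
    Continuous (ww (k := k) T1 T2 ε) := by
  obtain ⟨L, hL⟩ := ww_lip (k := k) (T1 := T1) h2 hn hn1 hε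
  exact hL.continuous

lemma DD_meas (h2 : IsCantor n2 T2) (hn : 0 < n2) (hn1 : n2 < 1) {ε : ℝ} (hε : 0 < ε)
    (i : Fin (k + 1)) : Measurable (DD (k := k) T1 T2 ε i) :=
  measurable_lineDeriv (ww_cont h2 hn hn1 hε)

lemma ww_aesm (P : Par k p q β n1 n2) (h1 : IsCantor n1 T1) (h2 : IsCantor n2 T2) (hn1 : n2 < 1) :
    AEStronglyMeasurable (ww (k := k) T1 T2 0) volume := by
  refine aestronglyMeasurable_of_tendsto_ae atTop (f := fun n => ww (k := k) T1 T2 (epsn n))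
    (fun n => (ww_cont h2 P.n2pos hn1 (epsn_pos n)).aestronglyMeasurable) ?_
  filter_upwards [ae_rho_pos (k := k) h1 h2] with x hx
  exact ww_tendsto (rho1_pos P.hk hx.2)

lemma DD_aesm (P : Par k p q β n1 n2) (h1 : IsCantor n1 T1) (h2 : IsCantor n2 T2) (hn1 : n2 < 1)
    (i : Fin (k + 1)) : AEStronglyMeasurable (DD (k := k) T1 T2 0 i) volume := by
  refine aestronglyMeasurable_of_tendsto_ae atTop (f := fun n => DD (k := k) T1 T2 (epsn n) i)
    (fun n => (DD_meas h2 P.n2pos hn1 (epsn_pos n) i).aestronglyMeasurable) ?_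
  filter_upwards [ae_rho_pos (k := k) h1 h2] with x hx
  exact DD_tendsto (rho1_pos P.hk hx.2) i

lemma ww_abs (ε : ℝ) (x : E (k + 1)) : |ww T1 T2 ε x| ≤ 1 / 2 := by
  unfold ww
  rw [abs_mul, abs_of_nonneg (cut_nonneg x)]
  have := uu_abs (T1 := T1) (T2 := T2) ε x
  nlinarith [cut_le x, cut_nonneg x, abs_nonneg (uu T1 T2 ε x)]

lemma ww_out {ε : ℝ} {x : E (k + 1)} (h : x ∉ cube (k + 1)) : ww T1 T2 ε x = 0 := by
  unfold ww; rw [cut_zero (by linarith [sn_cube h]), zero_mul]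

lemma DD_out {ε : ℝ} (i : Fin (k + 1)) {x : E (k + 1)} (h : x ∉ cube (k + 1)) :
    DD T1 T2 ε i x = 0 := DD_zero_out i (by linarith [sn_cube h])

lemma le_one_add_rpow {t p : ℝ} (ht : 0 ≤ t) (hp : 1 ≤ p) : t ≤ 1 + t ^ p := by
  rcases le_total t 1 with h | h
  · have := Real.rpow_nonneg ht p; linarith
  · have := Real.self_le_rpow_of_one_le h hp; linarith

lemma DD_dom_one (P : Par k p q β n1 n2) (h1 : IsCantor n1 T1) (h2 : IsCantor n2 T2)
    (hn1 : n2 < 1) :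
    ∃ H : E (k + 1) → ℝ, IntegrableOn H (cube (k + 1)) ∧
      ∀ᵐ x : E (k + 1), ∀ ε : ℝ, 0 ≤ ε → ∀ i, |DD T1 T2 ε i x| ≤ H x := by
  obtain ⟨H, hH, hH0, h⟩ := DD_dom P h1 h2 hn1
  refine ⟨fun x => 1 + H x, ?_, ?_⟩
  · have : IsFiniteMeasure (volume.restrict (cube (k + 1))) := ⟨by simpa using cube_finite (k + 1)⟩
    exact (integrable_const _).add hH
  · filter_upwards [ae_rho_pos (k := k) h1 h2] with x hx ε hε i
    have := h x hx ε hε i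
    have := le_one_add_rpow (abs_nonneg (DD T1 T2 ε i x)) P.hp.le
    linarith

def gg (T1 T2 : ℝ → ℝ) (x : E (k + 1)) : E (k + 1) := WithLp.toLp 2 (fun i => DD T1 T2 0 i x)

@[simp] lemma gg_apply (x : E (k + 1)) (i : Fin (k + 1)) : gg T1 T2 x i = DD T1 T2 0 i x := rfl

lemma norm_le_sum_coord {d : ℕ} (x : E d) : ‖x‖ ≤ ∑ i, |x i| := by
  rw [EuclideanSpace.norm_eq]
  apply Real.sqrt_le_iff.2
  refine ⟨Finset.sum_nonneg fun i _ => abs_nonneg _, ?_⟩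
  exact Finset.sum_sq_le_sq_sum_of_nonneg fun i _ => abs_nonneg _

lemma gg_aesm (P : Par k p q β n1 n2) (h1 : IsCantor n1 T1) (h2 : IsCantor n2 T2) (hn1 : n2 < 1) :
    AEStronglyMeasurable (gg (k := k) T1 T2) volume := by
  have h : AEMeasurable (fun x : E (k + 1) => fun i => DD T1 T2 0 i x) volume :=
    aemeasurable_pi_lambda _ fun i => (DD_aesm P h1 h2 hn1 i).aemeasurable
  exact ((PiLp.continuous_toLp 2 _).measurable.comp_aemeasurable h).aestronglyMeasurable

lemma gg_integrable (P : Par k p q β n1 n2) (h1 : IsCantor n1 T1) (h2 : IsCantor n2 T2)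
    (hn1 : n2 < 1) : IntegrableOn (gg (k := k) T1 T2) (cube (k + 1)) := by
  obtain ⟨H, hH, h⟩ := DD_dom_one (k := k) P h1 h2 hn1
  refine Integrable.mono' (hH.const_mul ((k:ℝ) + 1)) (gg_aesm P h1 h2 hn1).restrict ?_
  filter_upwards [ae_restrict_of_ae h] with x hx
  refine (norm_le_sum_coord _).trans ?_
  refine (Finset.sum_le_sum fun i _ => hx 0 le_rfl i).trans ?_
  simp

lemma ww_ibp (h2 : IsCantor n2 T2) (hn : 0 < n2) (hn1 : n2 < 1) {ε : ℝ} (hε : 0 < ε)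
    {ξ : E (k + 1) → ℝ} (hξ : ContDiff ℝ (⊤ : ℕ∞) ξ) (hc : HasCompactSupport ξ) (i : Fin (k + 1)) :
    ∫ x in cube (k + 1), ww T1 T2 ε x * fderiv ℝ ξ x (EuclideanSpace.single i 1) =
      - ∫ x in cube (k + 1), DD T1 T2 ε i x * ξ x := by
  obtain ⟨L, hL⟩ := ww_lip (k := k) (T1 := T1) h2 hn hn1 hε
  obtain ⟨M, hM⟩ := ContDiff.lipschitzWith_of_hasCompactSupport hc hξ (by simp)
  have := LipschitzWith.integral_lineDeriv_mul_eq (μ := volume) hL hM hc (EuclideanSpace.single i 1)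
  rw [setIntegral_eq_integral_of_forall_compl_eq_zero (fun x hx => by rw [ww_out hx, zero_mul]),
    setIntegral_eq_integral_of_forall_compl_eq_zero (fun x hx => by rw [DD_out i hx, zero_mul])]
  have e : ∀ x, lineDeriv ℝ ξ x (-(EuclideanSpace.single i 1 : E (k + 1))) * ww T1 T2 ε x =
      - (ww T1 T2 ε x * fderiv ℝ ξ x (EuclideanSpace.single i 1)) := by
    intro x
    rw [((hξ.differentiable (by simp)) x).lineDeriv_eq_fderiv, map_neg]
    ring
  simp_rw [e] at this
  rw [integral_neg] at this
  unfold DD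
  rw [this, neg_neg]

lemma ww_mem (P : Par k p q β n1 n2) (h1 : IsCantor n1 T1) (h2 : IsCantor n2 T2)
    (hn1 : n2 < 1) : MemW011 (k + 1) (ww T1 T2 0) (gg T1 T2) := by
  have hfin : IsFiniteMeasure (volume.restrict (cube (k + 1))) :=
    ⟨by simpa using cube_finite (k + 1)⟩
  obtain ⟨H, hH, hHb⟩ := DD_dom_one (k := k) P h1 h2 hn1
  refine ⟨?_, gg_integrable P h1 h2 hn1, ?_⟩
  · exact Integrable.of_bound (C := 1 / 2) (ww_aesm P h1 h2 hn1).restrict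
      (ae_of_all _ fun x => ww_abs 0 x)
  intro ξ hξ hc i
  have hpos := ae_restrict_of_ae (s := cube (k + 1)) (ae_rho_pos (k := k) h1 h2)
  have hdc : Continuous fun x => fderiv ℝ ξ x (EuclideanSpace.single i 1 : E (k + 1)) :=
    (hξ.continuous_fderiv (by simp)).clm_apply continuous_const
  have hds : HasCompactSupport fun x => fderiv ℝ ξ x (EuclideanSpace.single i 1 : E (k + 1)) :=
    hc.fderiv_apply ℝ _
  obtain ⟨B1, hB1⟩ := hds.exists_bound_of_continuous hdc
  obtain ⟨B0, hB0⟩ := hc.exists_bound_of_continuous hξ.continuous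
  have t1 : Tendsto (fun n => ∫ x in cube (k + 1), ww T1 T2 (epsn n) x *
      fderiv ℝ ξ x (EuclideanSpace.single i 1)) atTop
      (𝓝 (∫ x in cube (k + 1), ww T1 T2 0 x * fderiv ℝ ξ x (EuclideanSpace.single i 1))) := by
    refine tendsto_integral_of_dominated_convergence (fun _ => 1 / 2 * B1) (fun n => ?_)
      (integrable_const _) (fun n => ?_) ?_
    · exact ((ww_cont h2 P.n2pos hn1 (epsn_pos n)).mul hdc).aestronglyMeasurable
    · refine ae_of_all _ fun x => ?_
      rw [norm_mul]
      exact mul_le_mul (ww_abs _ x) (hB1 x) (norm_nonneg _) (by norm_num)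
    · filter_upwards [hpos] with x hx
      exact (ww_tendsto (rho1_pos P.hk hx.2)).mul_const _
  have t2 : Tendsto (fun n => ∫ x in cube (k + 1), DD T1 T2 (epsn n) i x * ξ x) atTop
      (𝓝 (∫ x in cube (k + 1), DD T1 T2 0 i x * ξ x)) := by
    refine tendsto_integral_of_dominated_convergence (fun x => H x * B0) (fun n => ?_)
      (hH.mul_const _) (fun n => ?_) ?_
    · exact ((DD_meas h2 P.n2pos hn1 (epsn_pos n) i).mul hξ.continuous.measurable).aestronglyMeasurable
    · filter_upwards [ae_restrict_of_ae hHb] with x hx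
      rw [norm_mul]
      have := hx (epsn n) (epsn_pos n).le i
      exact mul_le_mul this (hB0 x) (norm_nonneg _) ((abs_nonneg _).trans this)
    · filter_upwards [hpos] with x hx
      exact (DD_tendsto (rho1_pos P.hk hx.2) i).mul_const _
  refine tendsto_nhds_unique t1 (t2.neg.congr fun n => ?_)
  exact (ww_ibp h2 P.n2pos hn1 (epsn_pos n) hξ hc i).symm

lemma rpow_sum_bound {d : ℕ} {p A : ℝ} (hp : 0 < p) (x : E (d + 1)) (h : ∀ i, |x i| ^ p ≤ A) :
    ‖x‖ ^ p ≤ ((d:ℝ) + 1) ^ p * A := by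
  obtain ⟨i, -, hi⟩ := Finset.exists_max_image Finset.univ (fun i => |x i|) ⟨0, Finset.mem_univ _⟩
  have h1 : ‖x‖ ≤ ((d:ℝ) + 1) * |x i| := by
    refine (norm_le_sum_coord _).trans ?_
    refine (Finset.sum_le_sum fun j hj => hi j hj).trans ?_
    simp
  calc ‖x‖ ^ p ≤ (((d:ℝ) + 1) * |x i|) ^ p := Real.rpow_le_rpow (norm_nonneg _) h1 hp.le
    _ = ((d:ℝ) + 1) ^ p * |x i| ^ p := Real.mul_rpow (by positivity) (abs_nonneg _)
    _ ≤ _ := by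
      have := h i
      gcongr

lemma awt_le_one (h2 : IsCantor n2 T2) (hβ : 0 < β) {x : E (k + 1)} (hx : x ∈ cube (k + 1)) :
    awt T1 T2 β x ≤ 1 := by
  unfold awt
  apply Real.rpow_le_one (le_max_left _ _) _ hβ.le
  apply max_le zero_le_one
  have a := rho_le T2 (x 0) (t := 0) (by simp)
  rw [h2.zero, sub_zero] at a
  have b := abs_le.2 ⟨(hx 0).1.le, (hx 0).2.le⟩
  have c := rho1_nonneg T1 x
  linarith

lemma energy_integrable (P : Par k p q β n1 n2) (h1 : IsCantor n1 T1) (h2 : IsCantor n2 T2)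
    (hn1 : n2 < 1) :
    IntegrableOn (fun x : E (k + 1) => doublePhase p q (awt T1 T2 β x) ‖gg T1 T2 x‖)
      (cube (k + 1)) := by
  have hfin : IsFiniteMeasure (volume.restrict (cube (k + 1))) :=
    ⟨by simpa using cube_finite (k + 1)⟩
  obtain ⟨H, hH, hH0, h⟩ := DD_dom P h1 h2 hn1
  have hp : 0 < p := by linarith [P.hp]
  have hq : 0 < q := by linarith [P.hpq]
  have hm := gg_aesm P h1 h2 hn1
  have hmn : AEMeasurable (fun x : E (k + 1) => ‖gg T1 T2 x‖) volume := hm.norm.aemeasurable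
  have hma : AEMeasurable (awt (k := k) T1 T2 β) volume := (awt_cont T1 T2 P.hβ).measurable.aemeasurable
  refine Integrable.mono' (g := fun x => ((k:ℝ) + 1) ^ p * H x / p + ((k:ℝ) + 1) ^ q * (5 / 2) ^ q / q)
    (((hH.const_mul _).div_const _).add (integrable_const _)) ?_ ?_
  · apply AEMeasurable.aestronglyMeasurable
    apply AEMeasurable.restrict
    unfold doublePhase
    exact ((hmn.pow_const p).div_const p).add ((hma.mul (hmn.pow_const q)).div_const q)
  · filter_upwards [ae_restrict_of_ae (ae_rho_pos (k := k) h1 h2), ae_restrict_mem (cube_meas _)] with x hx hxc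
    rw [Real.norm_eq_abs, abs_of_nonneg (dp_nonneg hp hq (awt_nonneg _ _ _ _) (norm_nonneg _))]
    unfold doublePhase
    have a : ‖gg T1 T2 x‖ ^ p ≤ ((k:ℝ) + 1) ^ p * H x :=
      rpow_sum_bound hp _ fun i => h x hx 0 le_rfl i
    have b : awt T1 T2 β x * ‖gg T1 T2 x‖ ^ q ≤ ((k:ℝ) + 1) ^ q * (5 / 2) ^ q := by
      by_cases hc : MM T1 0 x < rho T2 (x 0)
      · have hM : 0 < MM T1 0 x := (rho1_pos P.hk hx.2).trans_le (le_max_left _ _)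
        have := rpow_sum_bound (A := (5 / 2) ^ q) hq (gg T1 T2 x) fun i =>
          Real.rpow_le_rpow (abs_nonneg _) (DD_bound_b i hM hc) hq.le
        exact (mul_le_of_le_one_left (by positivity) (awt_le_one h2 P.hβ hxc)).trans this
      · have : awt T1 T2 β x = 0 := by
          unfold awt
          unfold MM at hc
          rw [max_eq_left (rho1_nonneg _ _), not_lt] at hc
          rw [max_eq_left (by linarith), Real.zero_rpow P.hβ.ne']
        rw [this, zero_mul]; positivity
    gcongr
end

end

section

/-! ## The pairing of the field with the competitor -/

variable {k : ℕ}

def bet (T : ℝ → ℝ) (y : Y k) : ℝ := ∫ t in QQ k, kern T (fun _ => 1 / 4) 0 y t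

lemma bconst_eq {T : ℝ → ℝ} {h : ℝ} (hh : h ∈ II) (y : Y k) :
    bfield T (fun _ => 1 / 4) (pt h y) = bet T y • pt 1 0 := by
  unfold bfield bet
  rw [pt_zero, if_pos hh, hor_pt, ← integral_smul_const]
  congr 1
  funext t
  simp [dir, kern]

lemma pt_one_eq : (pt 1 0 : E (k + 1)) = EuclideanSpace.single 0 1 := by
  ext i
  refine Fin.cases ?_ (fun j => ?_) i
  · simp
  · simp [Fin.succ_ne_zero]

lemma pt_add_smul (h t : ℝ) (y : Y k) :
    pt h y + t • (EuclideanSpace.single 0 1 : E (k + 1)) = pt (h + t) y := by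
  ext i
  refine Fin.cases ?_ (fun j => ?_) i
  · simp
  · simp [Fin.succ_ne_zero]

section
variable {T1 T2 : ℝ → ℝ} {p q β n1 n2 : ℝ}

lemma bet_int_pos (h1 : IsCantor n1 T1) : 0 < ∫ y : Y k, bet T1 y := by
  have h0 : (0:ℝ) ∈ II := by unfold II; constructor <;> norm_num
  have := slice_formula (k := k) h1 isRad_const (h := 0) (by norm_num) h0
    (F := fun _ => pt 1 0) measurable_const (CF := ‖(pt 1 0 : E (k + 1))‖) (fun _ => le_rfl)
  have hn : ⟪(pt 1 0 : E (k + 1)), pt 1 0⟫ = 1 := by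
    rw [real_inner_self_eq_norm_sq, pt_one_eq, single_norm]; norm_num
  have e1 : ∀ y : Y k, ⟪bfield T1 (fun _ => 1 / 4) (pt 0 y), (pt 1 0 : E (k + 1))⟫ = bet T1 y := by
    intro y
    rw [bconst_eq h0, real_inner_smul_left, hn, mul_one]
  have e2 : ∀ z : Y k × Y k, crv T1 (fun _ => 1 / 4) (fun _ => (pt 1 0 : E (k + 1))) 0 z = 1 := by
    intro z
    unfold crv
    rw [deriv_const, zero_smul, hn]
  simp_rw [e1, e2] at this
  rw [this, integral_const, smul_eq_mul, mul_one]
  apply ENNReal.toReal_pos _ (measure_ne_top _ _)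
  unfold nuu
  rw [← univ_prod_univ, Measure.prod_prod, Measure.restrict_apply_univ, Measure.restrict_apply_univ,
    QQ_vol, one_mul]
  exact (measure_closedBall_pos _ _ (by norm_num)).ne'

lemma bet_meas (h1 : IsCantor n1 T1) : Measurable (bet (k := k) T1) := by
  have h0 : (0:ℝ) ∈ II := by unfold II; constructor <;> norm_num
  have e : bet (k := k) T1 = fun y => bfield T1 (fun _ => 1 / 4) (pt 0 y) 0 := by
    funext y
    rw [bconst_eq h0]; simp
  rw [e]
  have m1 := (bfield_meas (k := k) (r := fun _ => 1 / 4) h1.mono continuous_const).comp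
    (pt_meas' (measurable_const (a := (0:ℝ))) (measurable_id (α := Y k)))
  have m2 : Measurable fun x : E (k + 1) => x 0 := by fun_prop
  exact m2.comp m1

lemma line_integral (P : Par k p q β n1 n2) (h1 : IsCantor n1 T1) (h2 : IsCantor n2 T2)
    (hn1 : n2 < 1) {y : Y k} (hy : ∀ i, 0 < rho T1 (y i)) (hb : bet T1 y ≠ 0) :
    ∫ h in II, DD T1 T2 0 0 (pt h y) = 1 := by
  have hne : ∀ h ∈ II, bfield T1 (fun _ => 1 / 4) (pt h y) ≠ 0 := by
    intro h hh h0
    rw [bconst_eq hh] at h0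
    have := congrArg (fun v : E (k + 1) => v 0) h0
    simp at this
    exact hb this
  have hK : ∀ h ∈ II, pt h y ∈ KK k := by
    intro h hh
    by_contra hc
    exact hne h hh (bfield_support h1 isRad_const hc)
  have h0 : (0:ℝ) ∈ II := by unfold II; constructor <;> norm_num
  set R := rho1 T1 (pt 0 y) with hR
  have hRh : ∀ h, rho1 T1 (pt h y) = R := fun h => rfl
  have hRpos : 0 < R := rho1_pos P.hk hy
  have hR8 : R ≤ 1 / 8 := by
    have := rho1_le_of_ne (hne 0 h0)
    rw [hR]; linarith
  have hM0 : ∀ h, MM T1 0 (pt h y) = R := fun h => by unfold MM; rw [hRh, max_eq_left hRpos.le]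
  have hMR : ∀ h, MM T1 R (pt h y) = R := fun h => by unfold MM; rw [hRh, max_self]
  have hww : ∀ h, ww T1 T2 0 (pt h y) = ww T1 T2 R (pt h y) := fun h => by
    unfold ww uu; rw [hM0, hMR]
  obtain ⟨L, hL⟩ := ww_lip (k := k) (T1 := T1) h2 P.n2pos hn1 hRpos
  set f : ℝ → ℝ := fun h => ww T1 T2 0 (pt h y) with hf
  have hflip : LipschitzWith L f := by
    apply LipschitzWith.of_dist_le_mul
    intro a b
    simp only [hf, hww]
    refine (hL.dist_le_mul _ _).trans ?_
    gcongr
    rw [dist_eq_norm, pt_sub, sub_self]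
    refine (norm_pt_le _ _).trans ?_
    simp [Real.dist_eq]
  have := ftc_II (f := f) (g := fun h => DD T1 T2 0 0 (pt h y)) hflip.lipschitzOnWith (by
    refine ae_of_all _ fun h _ => ?_
    unfold DD lineDeriv
    simp_rw [pt_add_smul]
    have := deriv_comp_const_add f h 0
    rw [add_zero] at this
    exact this.symm)
  rw [this]
  have hval : ∀ (h c : ℝ), h ∈ II → (∀ τ ∈ Icc (0:ℝ) 1, clip ((h - T2 τ) / R) = c) → f h = 1 / 2 * c := by
    intro h c hh hc
    simp only [hf]
    unfold ww uu
    rw [cut_one (by linarith [sn_KK (hK h hh)]), one_mul, hM0, pt_zero]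
    congr 1
    rw [setIntegral_congr_fun measurableSet_Icc (g := fun _ => c) (fun τ hτ => hc τ hτ)]
    simp
  rw [hval (1 / 2) 1 (by unfold II; constructor <;> norm_num) ?_,
    hval (-1 / 4) (-1) (by unfold II; constructor <;> norm_num) ?_]
  · norm_num
  · intro τ hτ
    have := h2.mem hτ
    apply clip_neg_one
    rw [div_le_iff₀ hRpos]
    linarith [this.1]
  · intro τ hτ
    have := h2.mem hτ
    apply clip_one
    rw [one_le_div hRpos]
    linarith [this.2]

lemma pairing (P : Par k p q β n1 n2) (h1 : IsCantor n1 T1) (h2 : IsCantor n2 T2)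
    (hn1 : n2 < 1) :
    ∫ x in cube (k + 1), ⟪bb T1 T2 x, gg T1 T2 x⟫ = - ∫ y : Y k, bet T1 y := by
  have hg0 : ∀ x : E (k + 1), x ∉ cube (k + 1) → gg T1 T2 x = 0 := by
    intro x hx
    ext i
    exact DD_out i hx
  have hgi : Integrable (gg (k := k) T1 T2) := by
    have := (integrable_indicator_iff (cube_meas _)).2 (gg_integrable P h1 h2 hn1)
    rwa [indicator_eq_self.2 (fun x hx => by_contra fun hc => hx (hg0 x hc))] at this
  rw [setIntegral_eq_integral_of_forall_compl_eq_zero (fun x hx => by rw [hg0 x hx, inner_zero_right])]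
  have e1 : ∫ x : E (k + 1), ⟪bb T1 T2 x, gg T1 T2 x⟫ =
      ∫ x : E (k + 1), -⟪bfield T1 (fun _ => 1 / 4) x, gg T1 T2 x⟫ := by
    apply integral_congr_ae
    filter_upwards [ae_rho_pos (k := k) h1 h2] with x hx
    unfold bb
    rw [inner_sub_left]
    have : ⟪bfield T1 (rho T2) x, gg T1 T2 x⟫ = 0 := by
      by_cases hb : bfield T1 (rho T2) x = 0
      · rw [hb, inner_zero_left]
      · have hK : x ∈ KK k := by
          by_contra hc
          exact hb (bfield_support h1 (isRad_rho h2) hc)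
        have hr := rho1_le_of_ne hb
        have hp := rho1_pos P.hk hx.2
        have hM : MM T1 0 x = rho1 T1 x := max_eq_left hp.le
        have : gg T1 T2 x = 0 := by
          ext i
          exact DD_zero_in i (by linarith [sn_KK hK]) (by rw [hM]; exact hp) (by rw [hM]; linarith [hx.1])
        rw [this, inner_zero_right]
    rw [this, zero_sub]
  rw [e1, integral_neg]
  congr 1
  have hIntg : Integrable (fun x : E (k + 1) => ⟪bfield T1 (fun _ => 1 / 4) x, gg T1 T2 x⟫) := by
    obtain ⟨B, hB, hb⟩ := bconst_bound (k := k) h1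
    refine Integrable.mono' (hgi.norm.const_mul B) ?_ (ae_of_all _ fun x => ?_)
    · exact ((bfield_meas h1.mono continuous_const).aestronglyMeasurable).inner hgi.1
    · refine (norm_inner_le_norm _ _).trans ?_
      gcongr
      exact hb x
  rw [integral_pt, Measure.volume_eq_prod, integral_prod_symm _ (integrable_pt hIntg)]
  apply integral_congr_ae
  filter_upwards [ae_pt (ae_rho_pos (k := k) h1 h2)] with y hy
  obtain ⟨t, ht⟩ := hy.exists
  have hy' : ∀ i, 0 < rho T1 (y i) := ht.2
  have e2 : ∀ h : ℝ, ⟪bfield T1 (fun _ => 1 / 4) (pt h y), gg T1 T2 (pt h y)⟫ =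
      II.indicator (fun h => bet T1 y * DD T1 T2 0 0 (pt h y)) h := by
    intro h
    by_cases hh : h ∈ II
    · rw [indicator_of_mem hh, bconst_eq hh, real_inner_smul_left, pt_one_eq,
        EuclideanSpace.inner_single_left]
      simp
    · rw [indicator_of_notMem hh]
      have : bfield T1 (fun _ => 1 / 4) (pt h y) = 0 := by
        by_contra hc
        exact hh (mem_II_of_ne hc)
      rw [this, inner_zero_left]
  simp_rw [e2]
  rw [integral_indicator (by unfold II; exact measurableSet_Icc), integral_const_mul]
  by_cases hb : bet T1 y = 0
  · rw [hb, zero_mul]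
  · rw [line_integral P h1 h2 hn1 hy' hb, mul_one]
end

end

section

/-! ## Choice of parameters, scaling and conclusion -/

lemma exists_par {k : ℕ} (hk : 0 < k) {p q α : ℝ} (hp : 1 < p) (hα : 0 < α)
    (hq : p + α * max 1 ((p - 1) / (k : ℝ)) < q) :
    ∃ n1 n2 : ℝ, Par k p q (min α 1) n1 n2 ∧ n1 < 1 ∧ n2 < 1 := by
  have hkp : (0:ℝ) < k := by exact_mod_cast hk
  set M := max 1 ((p - 1) / (k : ℝ)) with hM
  have hM1 : 1 ≤ M := le_max_left _ _
  have hM2 : (p - 1) / (k : ℝ) ≤ M := le_max_right _ _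
  set β := min α 1 with hβ
  have hβ0 : 0 < β := lt_min hα one_pos
  have hβα : β ≤ α := min_le_left _ _
  have hβ1 : β ≤ 1 := min_le_right _ _
  have h1 : M < (q - p) / β := by
    rw [lt_div_iff₀ hβ0]
    nlinarith
  obtain ⟨N, hN1, hN2⟩ := exists_between h1
  have hN0 : 0 < N := by linarith
  rw [lt_div_iff₀ hβ0] at hN2
  have a1 : N⁻¹ * (p - 1) < k := by
    rw [inv_mul_lt_iff₀ hN0, ← div_lt_iff₀ hkp]; linarith
  have a2 : N⁻¹ * (p - 1) < N⁻¹ * (q - 1) - β := by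
    have : β = N⁻¹ * (N * β) := by field_simp
    rw [this, ← mul_sub]
    apply mul_lt_mul_of_pos_left _ (inv_pos.2 hN0)
    linarith
  obtain ⟨m, hm1, hm2⟩ := exists_between (lt_min a1 a2)
  have hm3 : m < k := hm2.trans_le (min_le_left _ _)
  have hm4 : m < N⁻¹ * (q - 1) - β := hm2.trans_le (min_le_right _ _)
  have hm0 : 0 < m := lt_trans (mul_pos (inv_pos.2 hN0) (by linarith)) hm1
  have hkm : (k:ℝ) * (m / k) = m := by field_simp
  refine ⟨m / k, N⁻¹, ⟨hk, hp, ?_, hβ0, hβ1, by positivity, by positivity, ?_, ?_⟩, ?_, ?_⟩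
  · nlinarith
  · rw [hkm]; exact hm1
  · rw [hkm]; linarith
  · rw [div_lt_one hkp]; exact hm3
  · exact inv_lt_one_of_one_lt₀ (by linarith)

lemma dp_scale {p q a s t : ℝ} (hp : 1 < p) (hpq : p < q) (ha : 0 ≤ a) (hs : 0 < s) (hs1 : s ≤ 1)
    (ht : 0 ≤ t) : doublePhase p q a (s * t) ≤ s ^ p * doublePhase p q a t := by
  unfold doublePhase
  rw [Real.mul_rpow hs.le ht, Real.mul_rpow hs.le ht]
  have h : s ^ q ≤ s ^ p := Real.rpow_le_rpow_of_exponent_ge hs hs1 hpq.le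
  have hq : 0 < q := by linarith
  have h2 : a * (s ^ q * t ^ q) / q ≤ s ^ p * (a * t ^ q / q) := by
    have e : a * (s ^ q * t ^ q) / q = s ^ q * (a * t ^ q / q) := by ring
    rw [e]
    gcongr
  have e : s ^ p * (t ^ p / p + a * t ^ q / q) = s ^ p * t ^ p / p + s ^ p * (a * t ^ q / q) := by ring
  linarith

lemma exists_scale {p A B : ℝ} (hp : 1 < p) (hA : 0 ≤ A) (hB : 0 < B) :
    ∃ s, 0 < s ∧ s ≤ 1 ∧ s ^ p * A - s * B < 0 := by
  set c := B / (A + 1) with hc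
  have hc0 : 0 < c := by positivity
  refine ⟨min 1 (c ^ (p - 1)⁻¹), lt_min one_pos (by positivity), min_le_left _ _, ?_⟩
  set s := min 1 (c ^ (p - 1)⁻¹) with hs
  have hs0 : 0 < s := lt_min one_pos (by positivity)
  have h1 : s ^ (p - 1) ≤ c := by
    calc s ^ (p - 1) ≤ (c ^ (p - 1)⁻¹) ^ (p - 1) :=
          Real.rpow_le_rpow hs0.le (min_le_right _ _) (by linarith)
      _ = c := by rw [← Real.rpow_mul hc0.le, inv_mul_cancel₀ (by linarith), Real.rpow_one]
  have e : s ^ p = s * s ^ (p - 1) := by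
    rw [Real.rpow_sub_one hs0.ne']; field_simp
  have h2 : c * A < B := by
    rw [hc, div_mul_eq_mul_div, div_lt_iff₀ (by positivity)]; nlinarith
  have h3 : s ^ (p - 1) * A ≤ c * A := by gcongr
  rw [e]
  nlinarith

lemma memW_smul {d : ℕ} {w : E d → ℝ} {g : E d → E d} (h : MemW011 d w g) (s : ℝ) :
    MemW011 d (fun x => s * w x) (fun x => s • g x) := by
  obtain ⟨a, b, c⟩ := h
  refine ⟨a.const_mul s, b.smul s, fun ξ h1 h2 i => ?_⟩
  have := c ξ h1 h2 i
  simp only [PiLp.smul_apply, smul_eq_mul, mul_assoc]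
  rw [integral_const_mul, integral_const_mul, this]
  ring


end


/-- Theorem: Lavrentiev gap for the double phase potential, without
any dimensional threshold. Let `Ω = (−1,1)^d`, `d ≥ 2`, `p > 1`, `α > 0` and
`q > p + α·max{1,(p−1)/(d−1)}`. There are a nonnegative weight `a ∈ C^{0,α}(Ω̄)`
and a compactly supported `b° ∈ L^1(Ω;ℝ^d)` with `∫_Ω φ*(x,|b°|) dx < ∞`, where
`φ(x,t) = t^p/p + a(x)t^q/q`, such that:
(i) `∫_Ω b°·∇v dx = 0` for every `v ∈ C^∞(Ω)`, hence
`G(v) = ∫_Ω φ(x,|∇v|) dx + ∫_Ω b°·∇v dx ≥ 0` for every `v ∈ C_c^∞(Ω)` and `G(0) = 0`;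
(ii) there is `w ∈ W_0^{1,1}(Ω)` with `∫_Ω φ(x,|∇w|) dx < ∞` and `G(w) < 0`. -/
theorem statement_18 (d : ℕ) (hd : 2 ≤ d) (p α q : ℝ) (hp : 1 < p) (hα : 0 < α)
    (hq : p + α * max 1 ((p - 1) / ((d : ℝ) - 1)) < q) :
    ∃ a : E d → ℝ, (∀ x, 0 ≤ a x) ∧
      (∃ Ca : ℝ≥0, HolderOnWith Ca (Real.toNNReal (min α 1)) a (closure (cube d))) ∧
      ∃ b0 : E d → E d,
        IntegrableOn b0 (cube d) volume ∧
        (∃ K : Set (E d), IsCompact K ∧ K ⊆ cube d ∧ ∀ x ∉ K, b0 x = 0) ∧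
        IntegrableOn (fun x => conjFn (doublePhase p q (a x)) ‖b0 x‖) (cube d) volume ∧
        (∀ v : E d → ℝ, ContDiffOn ℝ (⊤ : ℕ∞) v (cube d) →
          ∫ x in cube d, ⟪b0 x, gradient v x⟫ = 0) ∧
        (∀ v : E d → ℝ, ContDiff ℝ (⊤ : ℕ∞) v → HasCompactSupport v → tsupport v ⊆ cube d →
          0 ≤ (∫ x in cube d, doublePhase p q (a x) ‖gradient v x‖) +
                ∫ x in cube d, ⟪b0 x, gradient v x⟫) ∧
        ((∫ x in cube d, doublePhase p q (a x) ‖gradient (fun _ : E d => (0:ℝ)) x‖) +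
            (∫ x in cube d, ⟪b0 x, gradient (fun _ : E d => (0:ℝ)) x⟫) = 0) ∧
        (∃ (w : E d → ℝ) (g : E d → E d), MemW011 d w g ∧
          IntegrableOn (fun x => doublePhase p q (a x) ‖g x‖) (cube d) volume ∧
          (∫ x in cube d, doublePhase p q (a x) ‖g x‖) +
              (∫ x in cube d, ⟪b0 x, g x⟫) < 0) := by
  obtain ⟨k, rfl⟩ : ∃ k, d = k + 1 := ⟨d - 1, by omega⟩
  have hk : 0 < k := by omega
  have hcast : ((k + 1 : ℕ) : ℝ) - 1 = k := by push_cast; ring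
  rw [hcast] at hq
  obtain ⟨n1, n2, P, hn1, hn2⟩ := exists_par hk hp hα hq
  obtain ⟨T1, h1⟩ := exists_isCantor P.n1pos hn1
  obtain ⟨T2, h2⟩ := exists_isCantor P.n2pos hn2
  have hp0 : 0 < p := by linarith
  have hq0 : 0 < q := by linarith [P.hpq]
  have hdiv : ∀ v : E (k + 1) → ℝ, ContDiffOn ℝ (⊤ : ℕ∞) v (cube (k + 1)) →
      ∫ x in cube (k + 1), ⟪bb T1 T2 x, gradient v x⟫ = 0 := fun v hv =>
    field_div_free h1 (isRad_rho h2) isRad_const (brho_integrable P h1 h2) (bconst_integrable h1) hv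
  refine ⟨awt T1 T2 (min α 1), awt_nonneg T1 T2 _, ⟨2, awt_holder T1 T2 P.hβ P.hβ1 _⟩,
    bb T1 T2, (bb_integrable P h1 h2).integrableOn, ⟨KK k, KK_compact, KK_sub, fun x hx => ?_⟩,
    conj_integrable P h1 h2, hdiv, fun v hv _ _ => ?_, ?_, ?_⟩
  · unfold bb
    rw [bfield_support h1 (isRad_rho h2) hx, bfield_support h1 isRad_const hx, sub_zero]
  · rw [hdiv v hv.contDiffOn, add_zero]
    exact integral_nonneg fun x => dp_nonneg hp0 hq0 (awt_nonneg _ _ _ _) (norm_nonneg _)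
  · rw [hdiv _ contDiffOn_const, add_zero]
    have e : ∀ x : E (k + 1), doublePhase p q (awt T1 T2 (min α 1) x)
        ‖gradient (fun _ : E (k + 1) => (0:ℝ)) x‖ = 0 := by
      intro x
      have : gradient (fun _ : E (k + 1) => (0:ℝ)) x = 0 := by
        unfold gradient; simp
      rw [this, norm_zero, dp_zero hp0 hq0]
    simp_rw [e]
    simp
  · have hE := energy_integrable P h1 h2 hn2
    set A := ∫ x in cube (k + 1), doublePhase p q (awt T1 T2 (min α 1) x) ‖gg T1 T2 x‖ with hA
    have hA0 : 0 ≤ A :=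
      integral_nonneg fun x => dp_nonneg hp0 hq0 (awt_nonneg _ _ _ _) (norm_nonneg _)
    have hB := bet_int_pos (k := k) h1
    obtain ⟨s, hs0, hs1, hs⟩ := exists_scale hp hA0 hB
    have hpt : ∀ x : E (k + 1), doublePhase p q (awt T1 T2 (min α 1) x) ‖s • gg T1 T2 x‖ ≤
        s ^ p * doublePhase p q (awt T1 T2 (min α 1) x) ‖gg T1 T2 x‖ := by
      intro x
      rw [norm_smul, Real.norm_eq_abs, abs_of_pos hs0]
      exact dp_scale hp P.hpq (awt_nonneg _ _ _ _) hs0 hs1 (norm_nonneg _)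
    have hI : IntegrableOn (fun x : E (k + 1) => doublePhase p q (awt T1 T2 (min α 1) x)
        ‖s • gg T1 T2 x‖) (cube (k + 1)) := by
      refine Integrable.mono' (hE.const_mul (s ^ p)) ?_ (ae_of_all _ fun x => ?_)
      · have hmn : AEMeasurable (fun x : E (k + 1) => ‖s • gg T1 T2 x‖) volume :=
          ((gg_aesm P h1 h2 hn2).const_smul s).norm.aemeasurable
        have hma : AEMeasurable (awt (k := k) T1 T2 (min α 1)) volume :=
          (awt_cont T1 T2 P.hβ).measurable.aemeasurable
        apply AEMeasurable.aestronglyMeasurable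
        apply AEMeasurable.restrict
        unfold doublePhase
        exact ((hmn.pow_const p).div_const p).add ((hma.mul (hmn.pow_const q)).div_const q)
      · rw [Real.norm_eq_abs, abs_of_nonneg (dp_nonneg hp0 hq0 (awt_nonneg _ _ _ _) (norm_nonneg _))]
        exact hpt x
    refine ⟨fun x => s * ww T1 T2 0 x, fun x => s • gg T1 T2 x, memW_smul (ww_mem P h1 h2 hn2) s,
      hI, ?_⟩
    have i1 : ∫ x in cube (k + 1), doublePhase p q (awt T1 T2 (min α 1) x) ‖s • gg T1 T2 x‖ ≤
        s ^ p * A := by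
      rw [hA, ← integral_const_mul]
      exact integral_mono hI (hE.const_mul _) hpt
    have i2 : ∫ x in cube (k + 1), ⟪bb T1 T2 x, s • gg T1 T2 x⟫ = - (s * ∫ y : Y k, bet T1 y) := by
      simp_rw [real_inner_smul_right]
      rw [integral_const_mul, pairing P h1 h2 hn2]
      ring
    rw [i2]
    linarith
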